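/- arXiv:1907.09129 — 2 statements merged into one kernel-verified Lean document; each statement's English description precedes it below -/
import Mathlib

section
/- Let α > 0 be a real number. Then as x → ∞, Σ_{x^{1/3} < p ≤ x^{1/3}(log x)^{4/α}, p prime} 1/(p^{(3α/2)+1} (log(x/p))²) = (9/(2α))·1/(x^{α/2} (log x)^3) + O(1/(x^{α/2} (log x)^4)). -/
open Filter Finset

/-- The Euler–Maclaurin summand `n⁻ˢ - ∫_{n}^{n+1} u⁻ˢ du`, with `n + 1` in place of `n`. -/
noncomputable def zetaSummand (n : ℕ) (s : ℂ) : ℂ :=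
  (((n : ℝ) + 1 : ℝ) : ℂ) ^ (-s)
    - ((((n : ℝ) + 2 : ℝ) : ℂ) ^ (1 - s) - (((n : ℝ) + 1 : ℝ) : ℂ) ^ (1 - s)) / (1 - s)

lemma zetaSummand_eq_integral (n : ℕ) {s : ℂ} (hs : s ≠ 1) :
    zetaSummand n s = ∫ u in ((n : ℝ) + 1)..((n : ℝ) + 2),
      ((((n : ℝ) + 1 : ℝ) : ℂ) ^ (-s) - (u : ℂ) ^ (-s)) := by
  have h0 : (0 : ℝ) ∉ Set.uIcc ((n : ℝ) + 1) ((n : ℝ) + 2) := by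
    rw [Set.uIcc_of_le (by linarith)]
    intro h
    have := h.1
    have hn : (0 : ℝ) ≤ n := n.cast_nonneg
    linarith
  have h1 : -s ≠ -1 := fun h => hs (neg_injective h)
  rw [intervalIntegral.integral_sub intervalIntegrable_const
    (intervalIntegral.intervalIntegrable_cpow (Or.inr h0)), integral_cpow (Or.inr ⟨h1, h0⟩)]
  rw [zetaSummand, intervalIntegral.integral_const, show -s + 1 = 1 - s by ring]
  congr 1
  rw [show (n : ℝ) + 2 - (n + 1) = 1 by ring, one_smul]

lemma norm_cpow_neg_sub_cpow_neg_le {a u : ℝ} (ha : 0 < a) (hau : a ≤ u) (hu : u ≤ a + 1)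
    {s : ℂ} (hs : 0 < s.re) :
    ‖(a : ℂ) ^ (-s) - (u : ℂ) ^ (-s)‖ ≤ ‖s‖ * a ^ (-(s.re + 1)) := by
  have hs0 : -s ≠ 0 := by
    intro h
    rw [neg_eq_zero] at h
    simp [h] at hs
  have key := (convex_Icc a (a + 1)).norm_image_sub_le_of_norm_hasDerivWithin_le
    (f := fun x : ℝ => (x : ℂ) ^ (-s)) (f' := fun x : ℝ => (-s) * (x : ℂ) ^ (-s - 1))
    (C := ‖s‖ * a ^ (-(s.re + 1))) (x := u) (y := a) ?_ ?_ ⟨hau, hu⟩ ⟨le_rfl, by linarith⟩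
  · refine key.trans ?_
    have : ‖a - u‖ ≤ 1 := by
      rw [Real.norm_eq_abs, abs_le]; constructor <;> linarith
    exact mul_le_of_le_one_right (by positivity) this
  · intro x hx
    have hx0 : 0 < x := ha.trans_le hx.1
    exact (hasDerivAt_ofReal_cpow_const hx0.ne' (by simpa using hs0)).hasDerivWithinAt
  · intro x hx
    have hx0 : 0 < x := ha.trans_le hx.1
    rw [norm_mul, norm_neg, Complex.norm_cpow_eq_rpow_re_of_pos hx0]
    refine mul_le_mul_of_nonneg_left ?_ (norm_nonneg _)
    have : (-s - 1).re = -(s.re + 1) := by simp; ring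
    rw [this]
    exact Real.rpow_le_rpow_of_nonpos ha hx.1 (by linarith)

lemma norm_zetaSummand_le (n : ℕ) {s : ℂ} (hs : s ≠ 1) (hre : 49 / 50 < s.re) :
    ‖zetaSummand n s‖ ≤ 2 * ‖s‖ ^ (1 / 30 : ℝ) * ((n : ℝ) + 1) ^ (-(76 / 75) : ℝ) := by
  have hn : (1 : ℝ) ≤ (n : ℝ) + 1 := by
    have : (0 : ℝ) ≤ n := n.cast_nonneg
    linarith
  have hpos : (0 : ℝ) < (n : ℝ) + 1 := by linarith
  have hint : ∀ K : ℝ, (∀ u ∈ Set.Icc ((n : ℝ) + 1) ((n : ℝ) + 2),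
      ‖(((n : ℝ) + 1 : ℝ) : ℂ) ^ (-s) - (u : ℂ) ^ (-s)‖ ≤ K) → ‖zetaSummand n s‖ ≤ K := by
    intro K hK
    rw [zetaSummand_eq_integral n hs]
    have := intervalIntegral.norm_integral_le_of_norm_le_const
      (a := (n : ℝ) + 1) (b := (n : ℝ) + 2) (C := K)
      (f := fun u : ℝ => (((n : ℝ) + 1 : ℝ) : ℂ) ^ (-s) - (u : ℂ) ^ (-s)) ?_
    · refine this.trans_eq ?_
      rw [show (n : ℝ) + 2 - (n + 1) = 1 by ring, abs_one, mul_one]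
    · intro u hu
      rw [Set.uIoc_of_le (by linarith)] at hu
      exact hK u ⟨hu.1.le, hu.2⟩
  have h1 : ‖zetaSummand n s‖ ≤ ‖s‖ * ((n : ℝ) + 1) ^ (-(s.re + 1)) :=
    hint _ fun u hu =>
      norm_cpow_neg_sub_cpow_neg_le hpos hu.1 (by linarith [hu.2]) (by linarith)
  have h2 : ‖zetaSummand n s‖ ≤ 2 * ((n : ℝ) + 1) ^ (-s.re) := by
    refine hint _ fun u hu => (norm_sub_le _ _).trans ?_
    have hu0 : 0 < u := hpos.trans_le hu.1
    rw [Complex.norm_cpow_eq_rpow_re_of_pos hpos, Complex.norm_cpow_eq_rpow_re_of_pos hu0,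
      Complex.neg_re, two_mul]
    exact add_le_add le_rfl (Real.rpow_le_rpow_of_nonpos hpos hu.1 (by linarith))
  have h3 : ‖zetaSummand n s‖ =
      ‖zetaSummand n s‖ ^ (1 / 30 : ℝ) * ‖zetaSummand n s‖ ^ (29 / 30 : ℝ) := by
    rw [← Real.rpow_add' (norm_nonneg _) (by norm_num)]
    norm_num
  rw [h3]
  calc ‖zetaSummand n s‖ ^ (1 / 30 : ℝ) * ‖zetaSummand n s‖ ^ (29 / 30 : ℝ)
      ≤ (‖s‖ * ((n : ℝ) + 1) ^ (-(s.re + 1))) ^ (1 / 30 : ℝ)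
        * (2 * ((n : ℝ) + 1) ^ (-s.re)) ^ (29 / 30 : ℝ) := by gcongr
    _ = (2 : ℝ) ^ (29 / 30 : ℝ) * ‖s‖ ^ (1 / 30 : ℝ) * ((n : ℝ) + 1) ^ (-(s.re + 1 / 30)) := by
      rw [Real.mul_rpow (norm_nonneg _) (by positivity), Real.mul_rpow (by norm_num)
        (by positivity), ← Real.rpow_mul hpos.le, ← Real.rpow_mul hpos.le]
      rw [show -(s.re + 1 / 30) = -(s.re + 1) * (1 / 30) + -s.re * (29 / 30) by ring,
        Real.rpow_add hpos]
      ring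
    _ ≤ 2 * ‖s‖ ^ (1 / 30 : ℝ) * ((n : ℝ) + 1) ^ (-(76 / 75) : ℝ) := by
      have : (2 : ℝ) ^ (29 / 30 : ℝ) ≤ 2 := by
        conv_rhs => rw [← Real.rpow_one 2]
        exact Real.rpow_le_rpow_of_exponent_le (by norm_num) (by norm_num)
      have h4 : ((n : ℝ) + 1) ^ (-(s.re + 1 / 30)) ≤ ((n : ℝ) + 1) ^ (-(76 / 75) : ℝ) :=
        Real.rpow_le_rpow_of_exponent_le hn (by linarith)
      gcongr

lemma summable_nat_add_one_rpow : Summable fun n : ℕ => ((n : ℝ) + 1) ^ (-(76 / 75) : ℝ) := by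
  have := (summable_nat_add_iff 1).mpr
    (Real.summable_nat_rpow (p := -(76 / 75)).mpr (by norm_num))
  simpa using this

lemma summable_zetaSummand {s : ℂ} (hs : s ≠ 1) (hre : 49 / 50 < s.re) :
    Summable fun n => zetaSummand n s :=
  Summable.of_norm_bounded (summable_nat_add_one_rpow.mul_left _)
    fun n => norm_zetaSummand_le n hs hre

lemma tsum_zetaSummand_eq {s : ℂ} (hs : 1 < s.re) :
    ∑' n, zetaSummand n s = riemannZeta s - 1 / (s - 1) := by
  have hs1 : s ≠ 1 := by rintro rfl; simp at hs
  have hs1' : s - 1 ≠ 0 := sub_ne_zero.mpr hs1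
  have hs1'' : 1 - s ≠ 0 := sub_ne_zero.mpr hs1.symm
  have hz : Summable fun n : ℕ => 1 / ((n : ℂ) + 1) ^ s := by
    have := (summable_nat_add_iff 1).mpr (Complex.summable_one_div_nat_cpow.mpr hs)
    simpa using this
  have h1 := (hz.hasSum).tendsto_sum_nat
  rw [← zeta_eq_tsum_one_div_nat_add_one_cpow hs] at h1
  have h2 := (summable_zetaSummand hs1 (by linarith)).hasSum.tendsto_sum_nat
  have h3 : Tendsto (fun N : ℕ => (((N : ℝ) + 1 : ℝ) : ℂ) ^ (1 - s)) atTop (nhds 0) := by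
    rw [tendsto_zero_iff_norm_tendsto_zero]
    have : (fun N : ℕ => ‖(((N : ℝ) + 1 : ℝ) : ℂ) ^ (1 - s)‖)
        = fun N : ℕ => ((N : ℝ) + 1) ^ (-(s.re - 1)) := by
      ext N
      rw [Complex.norm_cpow_eq_rpow_re_of_pos (by positivity)]
      simp
    rw [this]
    exact (tendsto_rpow_neg_atTop (by linarith)).comp
      (tendsto_atTop_add_const_right _ _ tendsto_natCast_atTop_atTop)
  have h4 : ∀ N : ℕ, ∑ n ∈ Finset.range N, zetaSummand n s =
      ∑ n ∈ Finset.range N, 1 / ((n : ℂ) + 1) ^ s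
        - ((((N : ℝ) + 1 : ℝ) : ℂ) ^ (1 - s) - 1) / (1 - s) := by
    intro N
    induction N with
    | zero => simp
    | succ N ih =>
      rw [Finset.sum_range_succ, ih, Finset.sum_range_succ, zetaSummand, Complex.cpow_neg]
      push_cast
      rw [show (N : ℂ) + 1 + 1 = N + 2 by ring]
      ring
  have h5 := h1.sub ((h3.sub_const 1).div_const (1 - s))
  refine tendsto_nhds_unique h2 ?_
  simp_rw [h4]
  convert h5 using 2
  field_simp
  ring

lemma differentiableAt_zetaSummand (n : ℕ) {s : ℂ} (hs : s ≠ 1) :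
    DifferentiableAt ℂ (zetaSummand n) s := by
  have hs1 : 1 - s ≠ 0 := sub_ne_zero.mpr hs.symm
  have h1 : (((n : ℝ) + 1 : ℝ) : ℂ) ≠ 0 := by
    rw [Complex.ofReal_ne_zero]; positivity
  have h2 : (((n : ℝ) + 2 : ℝ) : ℂ) ≠ 0 := by
    rw [Complex.ofReal_ne_zero]; positivity
  unfold zetaSummand
  refine DifferentiableAt.sub ?_ (DifferentiableAt.div (DifferentiableAt.sub ?_ ?_) ?_ hs1)
  · exact (differentiableAt_id.neg).const_cpow (Or.inl h1)
  · exact ((differentiableAt_const _).sub differentiableAt_id).const_cpow (Or.inl h2)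
  · exact ((differentiableAt_const _).sub differentiableAt_id).const_cpow (Or.inl h1)
  · exact (differentiableAt_const _).sub differentiableAt_id

lemma riemannZeta_eq_tsum_zetaSummand {s : ℂ} (hre : 49 / 50 < s.re) (him : 0 < s.im) :
    riemannZeta s = 1 / (s - 1) + ∑' n, zetaSummand n s := by
  let U : Set ℂ := {z | 49 / 50 < z.re} ∩ {z | 0 < z.im}
  have hUo : IsOpen U :=
    (isOpen_lt continuous_const Complex.continuous_re).inter
      (isOpen_lt continuous_const Complex.continuous_im)
  have hUc : Convex ℝ U :=
    (convex_halfSpace_re_gt _).inter (convex_halfSpace_im_gt _)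
  have hU1 : ∀ z ∈ U, z ≠ 1 := by
    rintro z ⟨-, hz⟩ rfl
    simp at hz
  have hT : DifferentiableOn ℂ (fun z => ∑' n, zetaSummand n z) U := by
    intro z hz
    let V := U ∩ Metric.ball z 1
    have hVo : IsOpen V := hUo.inter Metric.isOpen_ball
    have hd : DifferentiableOn ℂ (fun z => ∑' n, zetaSummand n z) V := by
      refine Complex.differentiableOn_tsum_of_summable_norm
        (u := fun n : ℕ => 2 * (‖z‖ + 1) ^ (1 / 30 : ℝ) * ((n : ℝ) + 1) ^ (-(76 / 75) : ℝ))
        (summable_nat_add_one_rpow.mul_left _) ?_ hVo ?_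
      · intro n w hw
        exact (differentiableAt_zetaSummand n (hU1 w hw.1)).differentiableWithinAt
      · intro n w hw
        refine (norm_zetaSummand_le n (hU1 w hw.1) hw.1.1).trans ?_
        have : ‖w‖ ≤ ‖z‖ + 1 := by
          have h1 := hw.2
          rw [mem_ball_iff_norm] at h1
          have h2 := norm_sub_norm_le w z
          linarith
        gcongr
    exact (hd.differentiableAt
      (hVo.mem_nhds ⟨hz, Metric.mem_ball_self one_pos⟩)).differentiableWithinAt
  have hz : DifferentiableOn ℂ (fun z => riemannZeta z) U := fun z hz =>
    (differentiableAt_riemannZeta (hU1 z hz)).differentiableWithinAt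
  have hR : DifferentiableOn ℂ (fun z => 1 / (z - 1) + ∑' n, zetaSummand n z) U := by
    refine DifferentiableOn.add ?_ hT
    intro z hz
    have := sub_ne_zero.mpr (hU1 z hz)
    exact DifferentiableAt.differentiableWithinAt (by fun_prop (disch := assumption))
  have hW : (2 + Complex.I) ∈ U := by
    constructor <;> norm_num [U]
  refine (hz.analyticOnNhd hUo).eqOn_of_preconnected_of_eventuallyEq (hR.analyticOnNhd hUo)
    hUc.isPreconnected hW ?_ ⟨hre, him⟩
  have : {z : ℂ | 1 < z.re} ∈ nhds (2 + Complex.I) :=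
    (isOpen_lt continuous_const Complex.continuous_re).mem_nhds (by norm_num)
  filter_upwards [this] with z hz
  rw [tsum_zetaSummand_eq hz]
  ring

lemma exists_norm_riemannZeta_le : ∃ C : ℝ, 1 ≤ C ∧ ∀ s : ℂ, 49 / 50 < s.re → s.re ≤ 4 →
    1 / 2 ≤ |s.im| → ‖riemannZeta s‖ ≤ C * |s.im| ^ (1 / 30 : ℝ) := by
  let S := ∑' n : ℕ, ((n : ℝ) + 1) ^ (-(76 / 75) : ℝ)
  have hS : 0 ≤ S := tsum_nonneg fun n => by positivity
  have key : ∀ s : ℂ, 49 / 50 < s.re → s.re ≤ 4 →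
      1 / 2 ≤ s.im → ‖riemannZeta s‖ ≤ (4 + 18 * S) * |s.im| ^ (1 / 30 : ℝ) := by
    intro s h1 h2 h3
    have him : 0 < s.im := by linarith
    have hs1 : s ≠ 1 := by rintro rfl; simp at him
    rw [riemannZeta_eq_tsum_zetaSummand h1 him, abs_of_pos him]
    have hsum : ‖∑' n, zetaSummand n s‖ ≤ 2 * ‖s‖ ^ (1 / 30 : ℝ) * S := by
      rw [← tsum_mul_left]
      exact tsum_of_norm_bounded (summable_nat_add_one_rpow.mul_left _).hasSum
        fun n => norm_zetaSummand_le n hs1 h1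
    have hinv : ‖1 / (s - 1)‖ ≤ 2 := by
      have : 1 / 2 ≤ ‖s - 1‖ := by
        refine h3.trans ((le_abs_self _).trans ?_)
        simpa using Complex.abs_im_le_norm (s - 1)
      rw [norm_div, norm_one, div_le_iff₀ (by linarith)]
      linarith
    have hns : ‖s‖ ≤ 9 * s.im := by
      refine (Complex.norm_le_abs_re_add_abs_im s).trans ?_
      rw [abs_of_pos him, abs_of_pos (by linarith)]
      linarith
    have h9 : ‖s‖ ^ (1 / 30 : ℝ) ≤ 9 * s.im ^ (1 / 30 : ℝ) := by
      calc ‖s‖ ^ (1 / 30 : ℝ) ≤ (9 * s.im) ^ (1 / 30 : ℝ) := by gcongr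
        _ = 9 ^ (1 / 30 : ℝ) * s.im ^ (1 / 30 : ℝ) := Real.mul_rpow (by norm_num) him.le
        _ ≤ 9 ^ (1 : ℝ) * s.im ^ (1 / 30 : ℝ) := by
          gcongr
          · norm_num
          · norm_num
        _ = _ := by rw [Real.rpow_one]
    have h10 : 1 / 2 ≤ s.im ^ (1 / 30 : ℝ) := by
      calc (1 / 2 : ℝ) = (1 / 2) ^ (1 : ℝ) := by rw [Real.rpow_one]
        _ ≤ (1 / 2) ^ (1 / 30 : ℝ) :=
          Real.rpow_le_rpow_of_exponent_ge (by norm_num) (by norm_num) (by norm_num)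
        _ ≤ _ := by gcongr
    calc ‖1 / (s - 1) + ∑' n, zetaSummand n s‖ ≤ 2 + 2 * ‖s‖ ^ (1 / 30 : ℝ) * S :=
          (norm_add_le _ _).trans (add_le_add hinv hsum)
      _ ≤ 4 * s.im ^ (1 / 30 : ℝ) + 2 * (9 * s.im ^ (1 / 30 : ℝ)) * S := by
          gcongr
          linarith
      _ = _ := by ring
  refine ⟨4 + 18 * S, by linarith, fun s h1 h2 h3 => ?_⟩
  rcases le_abs.mp h3 with h | h
  · exact key s h1 h2 h
  · have := key (starRingEnd ℂ s) (by simpa using h1) (by simpa using h2) (by simpa using h)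
    rw [riemannZeta_conj] at this
    simpa using this

lemma abs_im_le_of_norm_sub_le {z s : ℂ} {r : ℝ} (h : ‖z - s‖ ≤ r) :
    |s.im| - r ≤ |z.im| ∧ |z.im| ≤ |s.im| + r := by
  have h1 : |z.im - s.im| ≤ r := by
    simpa using (Complex.abs_im_le_norm (z - s)).trans h
  have h2 := abs_abs_sub_abs_le_abs_sub z.im s.im
  have h3 := abs_le.mp (h2.trans h1)
  constructor <;> linarith [h3.1, h3.2]

lemma abs_re_sub_le_of_norm_sub_le {z s : ℂ} {r : ℝ} (h : ‖z - s‖ ≤ r) :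
    s.re - r ≤ z.re ∧ z.re ≤ s.re + r := by
  have h1 : |z.re - s.re| ≤ r := by
    simpa using (Complex.abs_re_le_norm (z - s)).trans h
  have h3 := abs_le.mp h1
  constructor <;> linarith [h3.1, h3.2]

lemma rpow_one_div_thirty_le_two_mul {a b : ℝ} (ha : 0 ≤ a) (hb : 0 ≤ b) (h : a ≤ 2 * b) :
    a ^ (1 / 30 : ℝ) ≤ 2 * b ^ (1 / 30 : ℝ) := by
  calc a ^ (1 / 30 : ℝ) ≤ (2 * b) ^ (1 / 30 : ℝ) := by gcongr
    _ = 2 ^ (1 / 30 : ℝ) * b ^ (1 / 30 : ℝ) := Real.mul_rpow (by norm_num) hb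
    _ ≤ 2 ^ (1 : ℝ) * b ^ (1 / 30 : ℝ) := by
      gcongr
      · norm_num
      · norm_num
    _ = _ := by rw [Real.rpow_one]

lemma ne_one_of_abs_im_pos {s : ℂ} (h : 0 < |s.im|) : s ≠ 1 := by
  rintro rfl
  simp at h

lemma exists_norm_deriv_riemannZeta_le : ∃ C : ℝ, 1 ≤ C ∧
    (∀ s : ℂ, 119 / 120 ≤ s.re → s.re ≤ 3 → 3 / 4 ≤ |s.im| →
      ‖riemannZeta s‖ ≤ C * |s.im| ^ (1 / 30 : ℝ)) ∧
    ∀ s : ℂ, 119 / 120 ≤ s.re → s.re ≤ 3 → 3 / 4 ≤ |s.im| →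
      ‖deriv riemannZeta s‖ ≤ C * |s.im| ^ (1 / 30 : ℝ) := by
  obtain ⟨C, hC1, hC⟩ := exists_norm_riemannZeta_le
  refine ⟨240 * C, by linarith, fun s h1 h2 h3 => ?_, fun s h1 h2 h3 => ?_⟩
  · refine (hC s (by linarith) (by linarith) (by linarith)).trans ?_
    gcongr
    linarith
  have hd : DiffContOnCl ℂ riemannZeta (Metric.ball s (1 / 120)) := by
    refine DifferentiableOn.diffContOnCl fun z hz => ?_
    rw [closure_ball _ (by norm_num), mem_closedBall_iff_norm] at hz
    have := abs_im_le_of_norm_sub_le hz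
    exact (differentiableAt_riemannZeta
      (ne_one_of_abs_im_pos (by linarith [this.1]))).differentiableWithinAt
  refine (Complex.norm_deriv_le_of_forall_mem_sphere_norm_le (by norm_num) hd
    (C := C * (2 * |s.im| ^ (1 / 30 : ℝ))) fun z hz => ?_).trans_eq (by ring)
  rw [mem_sphere_iff_norm] at hz
  have him := abs_im_le_of_norm_sub_le hz.le
  have hre := abs_re_sub_le_of_norm_sub_le hz.le
  refine (hC z (by linarith) (by linarith) (by linarith)).trans ?_
  gcongr
  exact rpow_one_div_thirty_le_two_mul (abs_nonneg _) (abs_nonneg _) (by linarith)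

lemma exists_norm_riemannZeta_ofReal_le : ∃ A : ℝ, 1 ≤ A ∧ ∀ x : ℝ, 0 < x → x ≤ 1 →
    ‖riemannZeta (1 + x)‖ ≤ A / x := by
  obtain ⟨B, hB⟩ := (isCompact_Icc (a := (0 : ℝ)) (b := 1)).exists_bound_of_continuousOn
    (f := fun x : ℝ => riemannZeta₀ (1 + x))
    (differentiable_riemannZeta₀.continuous.comp (by fun_prop)).continuousOn
  have hB0 : 0 ≤ B := (norm_nonneg _).trans (hB 0 (by simp))
  refine ⟨1 + B, by linarith, fun x hx hx1 => ?_⟩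
  have hxne : (1 : ℂ) + x ≠ 1 := by simpa using hx.ne'
  rw [riemannZeta_eq_inv_sub_add hxne]
  refine (norm_add_le _ _).trans ?_
  have h1 : ‖((1 : ℂ) + x - 1)⁻¹‖ = 1 / x := by
    rw [add_sub_cancel_left, norm_inv, Complex.norm_real, Real.norm_of_nonneg hx.le, one_div]
  rw [h1, add_div]
  have h2 : B ≤ B / x := by
    rw [le_div_iff₀ hx]
    nlinarith
  linarith [hB x ⟨hx.le, hx1⟩]

lemma one_le_norm_riemannZeta_product {x : ℝ} (hx : 0 < x) (y : ℝ) :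
    1 ≤ ‖riemannZeta (1 + x)‖ ^ 3 * ‖riemannZeta (1 + x + Complex.I * y)‖ ^ 4
      * ‖riemannZeta (1 + x + 2 * Complex.I * y)‖ := by
  have := DirichletCharacter.norm_LFunction_product_ge_one
    (1 : DirichletCharacter ℂ 1) hx y
  simpa [DirichletCharacter.LFunctionTrivChar, DirichletCharacter.LFunction_modOne_eq] using this

lemma exists_le_norm_riemannZeta : ∃ D κ : ℝ, 1 ≤ D ∧ 0 < κ ∧ κ ≤ 1 ∧
    (∀ s : ℂ, 119 / 120 ≤ s.re → s.re ≤ 3 → 3 / 4 ≤ |s.im| →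
      ‖riemannZeta s‖ ≤ D * |s.im| ^ (1 / 30 : ℝ)) ∧
    (∀ s : ℂ, 119 / 120 ≤ s.re → s.re ≤ 3 → 3 / 4 ≤ |s.im| →
      ‖deriv riemannZeta s‖ ≤ D * |s.im| ^ (1 / 30 : ℝ)) ∧
    ∀ s : ℂ, 1 < s.re → s.re ≤ 2 → 1 ≤ |s.im| →
      κ * D / (|s.im| ^ (1 / 30 : ℝ)) ^ 4 ≤ ‖riemannZeta s‖ := by
  obtain ⟨D, hD1, hζ, hζ'⟩ := exists_norm_deriv_riemannZeta_le
  obtain ⟨A, hA1, hA⟩ := exists_norm_riemannZeta_ofReal_le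
  have hD0 : 0 < D := by linarith
  have hA0 : 0 < A := by linarith
  set κ : ℝ := 1 / (2 * A ^ 3 * D) / (16 * D ^ 4) with hκ
  have hκ0 : 0 < κ := by positivity
  have hκ1 : κ ≤ 1 := by
    rw [hκ, div_div, div_le_one (by positivity)]
    have h1 : 1 ≤ A ^ 3 := one_le_pow₀ hA1
    have h2 : 1 ≤ D ^ 4 := one_le_pow₀ hD1
    have h3 : 1 ≤ A ^ 3 * D := one_le_mul_of_one_le_of_one_le h1 hD1
    nlinarith
  refine ⟨D, κ, hD1, hκ0, hκ1, hζ, hζ', ?_⟩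
  intro s hs1 hs2 him
  set w : ℝ := |s.im| ^ (1 / 30 : ℝ) with hw
  have hw1 : 1 ≤ w := Real.one_le_rpow him (by norm_num)
  have hw0 : 0 < w := by linarith
  set δ : ℝ := κ / w ^ 5 with hδ
  have hδ0 : 0 < δ := by positivity
  have hδ1 : δ ≤ 1 := by
    rw [hδ, div_le_one (by positivity)]
    exact hκ1.trans (one_le_pow₀ hw1)
  have hfar : ∀ x : ℝ, δ ≤ x → x ≤ 1 →
      2 * D * κ / w ^ 4 ≤ ‖riemannZeta (1 + x + Complex.I * s.im)‖ := by
    intro x hx hx1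
    have hx0 : 0 < x := hδ0.trans_le hx
    have h1 := one_le_norm_riemannZeta_product hx0 s.im
    have h2 : ‖riemannZeta (1 + x + 2 * Complex.I * s.im)‖ ≤ D * (2 * w) := by
      have him2 : (1 + (x : ℂ) + 2 * Complex.I * s.im).im = 2 * s.im := by simp
      have hre2 : (1 + (x : ℂ) + 2 * Complex.I * s.im).re = 1 + x := by simp
      refine (hζ _ (by rw [hre2]; linarith) (by rw [hre2]; linarith) ?_).trans ?_
      · rw [him2, abs_mul, abs_two]; linarith
      · rw [him2, abs_mul, abs_two]
        gcongr
        exact rpow_one_div_thirty_le_two_mul (by positivity) (by positivity) le_rfl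
    set Z := ‖riemannZeta (1 + x + Complex.I * s.im)‖ with hZ
    have h3 : 1 ≤ (A / δ) ^ 3 * Z ^ 4 * (D * (2 * w)) := by
      refine h1.trans ?_
      have h4 : ‖riemannZeta (1 + x)‖ ≤ A / δ := by
        refine (hA x hx0 hx1).trans ?_
        gcongr
      gcongr
    have h4 : (2 * D * κ / w ^ 4) ^ 4 ≤ Z ^ 4 := by
      have h5 : (2 * D * κ / w ^ 4) ^ 4 * ((A / δ) ^ 3 * (D * (2 * w))) = 1 := by
        rw [hδ, hκ]
        field_simp
        norm_num
      have h6 : 0 < (A / δ) ^ 3 * (D * (2 * w)) := by positivity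
      refine le_of_mul_le_mul_right ?_ h6
      rw [h5]
      linarith
    exact le_of_pow_le_pow_left₀ (by norm_num) (norm_nonneg _) h4
  have hs_eq : ((1 : ℂ) + ((s.re - 1 : ℝ) : ℂ) + Complex.I * s.im) = s := by
    apply Complex.ext <;> simp
  rcases le_or_gt δ (s.re - 1) with h | h
  · have := hfar (s.re - 1) h (by linarith)
    rw [hs_eq] at this
    refine le_trans (div_le_div_of_nonneg_right ?_ (by positivity)) this
    nlinarith [mul_pos hκ0 hD0]
  · have h1 := hfar δ le_rfl hδ1
    set s₁ : ℂ := 1 + δ + Complex.I * s.im with hs₁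
    let T : Set ℂ := {z | 1 ≤ z.re} ∩ {z | z.re ≤ 2} ∩ {z | z.im = s.im}
    have hT : Convex ℝ T :=
      ((convex_halfSpace_re_ge _).inter (convex_halfSpace_re_le _)).inter
        (convex_hyperplane Complex.imLm.isLinear _)
    have h2 : ‖riemannZeta s - riemannZeta s₁‖ ≤ D * w * ‖s - s₁‖ := by
      refine hT.norm_image_sub_le_of_norm_deriv_le (f := riemannZeta) ?_ ?_ ?_ ?_
      · rintro z ⟨-, hz⟩
        refine differentiableAt_riemannZeta (ne_one_of_abs_im_pos ?_)
        rw [show z.im = s.im from hz]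
        linarith
      · rintro z ⟨⟨hz1, hz2⟩, hz⟩
        have hz1 : 1 ≤ z.re := hz1
        have hz2 : z.re ≤ 2 := hz2
        have hz : z.im = s.im := hz
        have := hζ' z (by linarith) (by linarith) (by rw [hz]; linarith)
        rwa [hz] at this
      · refine ⟨⟨?_, ?_⟩, ?_⟩
        · simpa [hs₁] using hδ0.le
        · simp only [hs₁, Set.mem_ofPred_eq, Complex.add_re, Complex.one_re, Complex.ofReal_re,
            Complex.mul_re, Complex.I_re, Complex.I_im, Complex.ofReal_im]
          linarith
        · simp [hs₁]
      · exact ⟨⟨hs1.le, hs2⟩, rfl⟩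
    have h3 : ‖s - s₁‖ ≤ δ := by
      have : s - s₁ = ((s.re - 1 - δ : ℝ) : ℂ) := by
        apply Complex.ext
        · simp [hs₁]; ring
        · simp [hs₁]
      rw [this, Complex.norm_real, Real.norm_eq_abs, abs_le]
      constructor <;> linarith
    have h4 : D * w * δ = D * κ / w ^ 4 := by
      rw [hδ]; field_simp
    have h5 := norm_sub_norm_le (riemannZeta s₁) (riemannZeta s)
    rw [norm_sub_rev] at h5
    have h6 : D * w * ‖s - s₁‖ ≤ D * w * δ := by gcongr
    have h7 : 2 * D * κ / w ^ 4 = 2 * (D * κ / w ^ 4) := by ring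
    have h8 : κ * D / w ^ 4 = D * κ / w ^ 4 := by ring
    rw [h8]
    linarith

/-- The function `(-(deriv ζ / ζ) - ζ) s / (s (s + 1))`, continued analytically through `s = 1`. -/
noncomputable def perronZeta (s : ℂ) : ℂ :=
  (-(deriv riemannZeta₁ s / riemannZeta₁ s) - riemannZeta₀ s) * (1 / (s * (s + 1)))

lemma perronZeta_eq {s : ℂ} (hs : s ≠ 1) (hz : riemannZeta s ≠ 0) :
    perronZeta s =
      (-deriv riemannZeta s / riemannZeta s - riemannZeta s) * (1 / (s * (s + 1))) := by
  have h1 : s - 1 ≠ 0 := sub_ne_zero.mpr hs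
  have h2 : riemannZeta₁ s ≠ 0 := by
    intro h
    rw [riemannZeta_eq_inv_sub_mul hs, h, mul_zero] at hz
    exact hz rfl
  rw [perronZeta, deriv_riemannZeta_eq_neg_inv_sub_sq_mul_add hs]
  congr 1
  have h3 : riemannZeta s = (s - 1)⁻¹ + riemannZeta₀ s := riemannZeta_eq_inv_sub_add hs
  have h4 : riemannZeta₀ s = riemannZeta s - (s - 1)⁻¹ := by rw [h3]; ring
  rw [h4, riemannZeta_eq_inv_sub_mul hs]
  field_simp
  ring

lemma riemannZeta₁_ne_zero_of_one_le_re {s : ℂ} (hs : 1 ≤ s.re) : riemannZeta₁ s ≠ 0 := by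
  rcases eq_or_ne s 1 with rfl | h
  · simp
  · intro h0
    have := riemannZeta_ne_zero_of_one_le_re hs
    rw [riemannZeta_eq_inv_sub_mul h, h0, mul_zero] at this
    exact this rfl

lemma differentiableAt_perronZeta {s : ℂ} (hs : 0 < s.re) (hz : riemannZeta₁ s ≠ 0) :
    DifferentiableAt ℂ perronZeta s := by
  have h0 : s ≠ 0 := by rintro rfl; simp at hs
  have h1 : s + 1 ≠ 0 := by
    intro h
    have := congrArg Complex.re h
    simp at this
    linarith
  have h2 : DifferentiableAt ℂ (deriv riemannZeta₁) s :=
    differentiable_riemannZeta₁.deriv s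
  have h3 : s * (s + 1) ≠ 0 := mul_ne_zero h0 h1
  unfold perronZeta
  refine DifferentiableAt.mul (DifferentiableAt.sub (h2.div (differentiable_riemannZeta₁ s) hz).neg
    (differentiable_riemannZeta₀ s)) ?_
  fun_prop (disch := assumption)

lemma analyticAt_perronZeta {s : ℂ} (hs : 1 ≤ s.re) : AnalyticAt ℂ perronZeta s := by
  rw [Complex.analyticAt_iff_eventually_differentiableAt]
  have h1 : ∀ᶠ z in nhds s, riemannZeta₁ z ≠ 0 :=
    differentiable_riemannZeta₁.continuous.continuousAt.eventually_ne
      (riemannZeta₁_ne_zero_of_one_le_re hs)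
  have h2 : ∀ᶠ z : ℂ in nhds s, 0 < z.re :=
    (isOpen_lt continuous_const Complex.continuous_re).mem_nhds
      (show 0 < s.re by linarith)
  filter_upwards [h1, h2] with z hz1 hz2
  exact differentiableAt_perronZeta hz2 hz1

lemma exists_norm_iteratedDeriv_perronZeta_le_of_abs_im_ge : ∃ K : ℝ, 0 < K ∧
    ∀ n ≤ 2, ∀ s : ℂ, 1 < s.re → s.re ≤ 2 → 1 ≤ |s.im| →
      ‖iteratedDeriv n perronZeta s‖ ≤ K * (s.im ^ 2) ^ (-(3 / 4) : ℝ) := by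
  obtain ⟨D, κ, hD1, hκ0, hκ1, hζ, hζ', hlow⟩ := exists_le_norm_riemannZeta
  have hD0 : 0 < D := by linarith
  set ρ : ℝ := κ / 120 with hρ
  have hρ0 : 0 < ρ := by positivity
  have hρ1 : ρ ≤ 1 / 120 := by rw [hρ]; linarith
  set B : ℝ := (4 / κ + 2 * D) * 4 with hB
  have hB0 : 0 < B := by positivity
  refine ⟨2 * B / ρ ^ 2, by positivity, ?_⟩
  intro n hn s hs1 hs2 him
  set w : ℝ := |s.im| ^ (1 / 30 : ℝ) with hw
  have hw1 : 1 ≤ w := Real.one_le_rpow him (by norm_num)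
  have hw0 : 0 < w := by linarith
  set r : ℝ := ρ / w ^ 5 with hr
  have hr0 : 0 < r := by positivity
  have hrρ : r ≤ ρ := div_le_self hρ0.le (one_le_pow₀ hw1)
  have hdisc : ∀ z : ℂ, ‖z - s‖ ≤ r → z ≠ 1 ∧ 119 / 120 ≤ z.re ∧ z.re ≤ 3 ∧
      3 / 4 ≤ |z.im| ∧ |s.im| ≤ 2 * |z.im| ∧ |z.im| ^ (1 / 30 : ℝ) ≤ 2 * w := by
    intro z hz
    have h1 := abs_im_le_of_norm_sub_le hz
    have h2 := abs_re_sub_le_of_norm_sub_le hz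
    refine ⟨ne_one_of_abs_im_pos (by linarith), by linarith, by linarith, by linarith,
      by linarith, ?_⟩
    exact rpow_one_div_thirty_le_two_mul (abs_nonneg _) (abs_nonneg _) (by linarith)
  have hlow' : ∀ z : ℂ, ‖z - s‖ ≤ r → κ * D / w ^ 4 / 2 ≤ ‖riemannZeta z‖ := by
    intro z hz
    have h1 := hlow s hs1 hs2 him
    have h2 : ‖riemannZeta z - riemannZeta s‖ ≤ D * (2 * w) * ‖z - s‖ := by
      refine (convex_closedBall s r).norm_image_sub_le_of_norm_deriv_le (f := riemannZeta)
        ?_ ?_ (Metric.mem_closedBall_self hr0.le) (mem_closedBall_iff_norm.mpr hz)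
      · intro u hu
        exact differentiableAt_riemannZeta (hdisc u (mem_closedBall_iff_norm.mp hu)).1
      · intro u hu
        obtain ⟨-, h1, h2, h3, -, h4⟩ := hdisc u (mem_closedBall_iff_norm.mp hu)
        refine (hζ' u h1 h2 h3).trans ?_
        gcongr
    have h3 : D * (2 * w) * ‖z - s‖ ≤ D * (2 * w) * r := by gcongr
    have h4 : D * (2 * w) * r = κ * D / w ^ 4 / 60 := by
      rw [hr, hρ]; field_simp; norm_num
    have h5 := norm_sub_norm_le (riemannZeta s) (riemannZeta z)
    rw [norm_sub_rev] at h5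
    have h6 : 0 < κ * D / w ^ 4 := by positivity
    linarith
  have hne : ∀ z : ℂ, ‖z - s‖ ≤ r → riemannZeta z ≠ 0 := by
    intro z hz h0
    have := hlow' z hz
    rw [h0, norm_zero] at this
    have h6 : 0 < κ * D / w ^ 4 := by positivity
    linarith
  have hd : DiffContOnCl ℂ perronZeta (Metric.ball s r) := by
    refine DifferentiableOn.diffContOnCl fun z hz => ?_
    rw [closure_ball _ hr0.ne', mem_closedBall_iff_norm] at hz
    obtain ⟨h0, h1, -⟩ := hdisc z hz
    refine (differentiableAt_perronZeta (by linarith) ?_).differentiableWithinAt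
    intro h
    have := hne z hz
    rw [riemannZeta_eq_inv_sub_mul h0, h, mul_zero] at this
    exact this rfl
  have hs0 : s.im ≠ 0 := by
    intro h
    rw [h, abs_zero] at him
    linarith
  have hbound : ∀ z ∈ Metric.sphere s r, ‖perronZeta z‖ ≤ B * w ^ 5 / s.im ^ 2 := by
    intro z hz
    rw [mem_sphere_iff_norm] at hz
    obtain ⟨h0, h1, h2, h3, h4, h5⟩ := hdisc z hz.le
    rw [perronZeta_eq h0 (hne z hz.le), norm_mul]
    have h6 : ‖-deriv riemannZeta z / riemannZeta z - riemannZeta z‖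
        ≤ (4 / κ + 2 * D) * w ^ 5 := by
      refine (norm_sub_le _ _).trans ?_
      rw [norm_div, norm_neg]
      have e1 : ‖deriv riemannZeta z‖ ≤ D * (2 * w) := (hζ' z h1 h2 h3).trans (by gcongr)
      have e2 : ‖riemannZeta z‖ ≤ D * (2 * w) := (hζ z h1 h2 h3).trans (by gcongr)
      have e3 : ‖deriv riemannZeta z‖ / ‖riemannZeta z‖
          ≤ D * (2 * w) / (κ * D / w ^ 4 / 2) :=
        div_le_div₀ (by positivity) e1 (by positivity) (hlow' z hz.le)
      have e4 : D * (2 * w) / (κ * D / w ^ 4 / 2) = 4 / κ * w ^ 5 := by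
        field_simp; norm_num
      have e5 : w ≤ w ^ 5 := le_self_pow₀ hw1 (by norm_num)
      have e6 : D * (2 * w) ≤ 2 * D * w ^ 5 := by nlinarith
      linarith
    have h7 : ‖1 / (z * (z + 1))‖ ≤ 4 / s.im ^ 2 := by
      have e1 : |z.im| ≤ ‖z‖ := Complex.abs_im_le_norm z
      have e2 : |z.im| ≤ ‖z + 1‖ := by simpa using Complex.abs_im_le_norm (z + 1)
      have e0 : 0 < |z.im| := by linarith
      have e4 : 0 < ‖z‖ := by linarith
      have e5 : 0 < ‖z + 1‖ := by linarith
      rw [norm_div, norm_one, norm_mul, ← sq_abs s.im,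
        div_le_div_iff₀ (by positivity) (by positivity)]
      have e3 : |z.im| * |z.im| ≤ ‖z‖ * ‖z + 1‖ := by gcongr
      nlinarith [abs_nonneg s.im]
    calc _ ≤ (4 / κ + 2 * D) * w ^ 5 * (4 / s.im ^ 2) := by gcongr
      _ = _ := by rw [hB]; ring
  refine (Complex.norm_iteratedDeriv_le_of_forall_mem_sphere_norm_le n hr0 hd hbound).trans ?_
  have hfac : (n.factorial : ℝ) ≤ 2 := by
    have := Nat.factorial_le hn
    exact_mod_cast this
  have hrn : r ^ 2 ≤ r ^ n :=
    pow_le_pow_of_le_one hr0.le (by linarith) hn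
  have hw15 : w ^ 15 / s.im ^ 2 = (s.im ^ 2) ^ (-(3 / 4) : ℝ) := by
    have ht : 0 < |s.im| := by linarith
    rw [hw, ← sq_abs s.im, ← Real.rpow_natCast, ← Real.rpow_mul ht.le, ← Real.rpow_natCast,
      ← Real.rpow_mul ht.le, ← Real.rpow_sub ht]
    norm_num
  calc (n.factorial : ℝ) * (B * w ^ 5 / s.im ^ 2) / r ^ n
      ≤ 2 * (B * w ^ 5 / s.im ^ 2) / r ^ 2 := by gcongr
    _ = 2 * B / ρ ^ 2 * (w ^ 15 / s.im ^ 2) := by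
      rw [hr]; field_simp
    _ = _ := by rw [hw15]

lemma exists_norm_iteratedDeriv_perronZeta_le : ∃ K : ℝ, 0 < K ∧
    ∀ n ≤ 2, ∀ s : ℂ, 1 < s.re → s.re ≤ 2 →
      ‖iteratedDeriv n perronZeta s‖ ≤ K * (1 + s.im ^ 2) ^ (-(3 / 4) : ℝ) := by
  obtain ⟨K₁, hK₁, h₁⟩ := exists_norm_iteratedDeriv_perronZeta_le_of_abs_im_ge
  have hc : ∀ n : ℕ, ∃ B : ℝ, ∀ s ∈ Set.Icc (1 : ℝ) 2 ×ℂ Set.Icc (-1 : ℝ) 1,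
      ‖iteratedDeriv n perronZeta s‖ ≤ B := fun n =>
    (isCompact_Icc.reProdIm isCompact_Icc).exists_bound_of_continuousOn fun s hs => by
      rw [iteratedDeriv_eq_iterate]
      exact ((analyticAt_perronZeta hs.1.1).iterated_deriv n).continuousAt.continuousWithinAt
  choose B hB using hc
  set M : ℝ := max K₁ (max (B 0) (max (B 1) (B 2))) with hM
  have hM1 : K₁ ≤ M := le_max_left _ _
  have hM0 : 0 < M := hK₁.trans_le hM1
  have hMB : ∀ n ≤ 2, B n ≤ M := by
    intro n hn
    interval_cases n <;> simp [hM]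
  have key : ∀ y : ℝ, 0 < y → ∀ u : ℝ, 0 < u → u ≤ 2 * y →
      y ^ (-(3 / 4) : ℝ) ≤ 2 * u ^ (-(3 / 4) : ℝ) := by
    intro y hy u hu huy
    calc y ^ (-(3 / 4) : ℝ) ≤ (u / 2) ^ (-(3 / 4) : ℝ) :=
          Real.rpow_le_rpow_of_nonpos (by positivity) (by linarith) (by norm_num)
      _ = u ^ (-(3 / 4) : ℝ) * 2 ^ (3 / 4 : ℝ) := by
        rw [Real.div_rpow hu.le (by norm_num), Real.rpow_neg (by norm_num : (0 : ℝ) ≤ 2),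
          div_inv_eq_mul]
      _ ≤ u ^ (-(3 / 4) : ℝ) * 2 ^ (1 : ℝ) := by
        gcongr
        · norm_num
        · norm_num
      _ = _ := by rw [Real.rpow_one, mul_comm]
  refine ⟨2 * M, by positivity, fun n hn s hs1 hs2 => ?_⟩
  rcases le_total 1 |s.im| with h | h
  · refine (h₁ n hn s hs1 hs2 h).trans ?_
    have hsq : 1 ≤ s.im ^ 2 := by
      rw [← sq_abs]; exact one_le_pow₀ h
    have := key (s.im ^ 2) (by linarith) (1 + s.im ^ 2) (by linarith) (by linarith)
    calc K₁ * (s.im ^ 2) ^ (-(3 / 4) : ℝ) ≤ M * (2 * (1 + s.im ^ 2) ^ (-(3 / 4) : ℝ)) := by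
          gcongr
      _ = _ := by ring
  · have hsq : s.im ^ 2 ≤ 1 := by
      rw [← sq_abs]; exact pow_le_one₀ (abs_nonneg _) h
    have := key 1 one_pos (1 + s.im ^ 2) (by positivity) (by linarith)
    rw [Real.one_rpow] at this
    have hmem : s ∈ Set.Icc (1 : ℝ) 2 ×ℂ Set.Icc (-1 : ℝ) 1 :=
      ⟨⟨hs1.le, hs2⟩, abs_le.mp h⟩
    calc _ ≤ M * 1 := by rw [mul_one]; exact (hB n s hmem).trans (hMB n hn)
      _ ≤ M * (2 * (1 + s.im ^ 2) ^ (-(3 / 4) : ℝ)) := by gcongr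
      _ = _ := by ring

open MeasureTheory in
lemma norm_integral_exp_mul_eq {g g' : ℝ → ℂ} {L : ℝ} (hL : 0 < L)
    (hd : ∀ y, HasDerivAt g (g' y) y) (hg : Integrable g) (hg' : Integrable g') :
    ‖∫ y : ℝ, Complex.exp ((L * y : ℝ) * Complex.I) * g y‖
      = 1 / L * ‖∫ y : ℝ, Complex.exp ((L * y : ℝ) * Complex.I) * g' y‖ := by
  have hc : Continuous fun y : ℝ => Complex.exp ((L * y : ℝ) * Complex.I) := by fun_prop
  have hmul : ∀ {h : ℝ → ℂ}, Integrable h →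
      Integrable fun y : ℝ => Complex.exp ((L * y : ℝ) * Complex.I) * h y := fun hh =>
    hh.bdd_mul (c := 1) hc.aestronglyMeasurable
      (Filter.Eventually.of_forall fun y => (Complex.norm_exp_ofReal_mul_I _).le)
  have hu : ∀ y : ℝ, HasDerivAt (fun y : ℝ => Complex.exp ((L * y : ℝ) * Complex.I))
      (Complex.exp ((L * y : ℝ) * Complex.I) * (L * Complex.I)) y := by
    intro y
    have h1 : HasDerivAt (fun y : ℝ => ((L * y : ℝ) : ℂ) * Complex.I) (L * Complex.I) y := by
      have := ((hasDerivAt_id y).const_mul L).ofReal_comp.mul_const Complex.I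
      simpa using this
    exact h1.cexp
  have key := integral_mul_deriv_eq_deriv_mul_of_integrable
    (u := fun y : ℝ => Complex.exp ((L * y : ℝ) * Complex.I)) (v := g)
    (u' := fun y : ℝ => Complex.exp ((L * y : ℝ) * Complex.I) * (L * Complex.I)) (v' := g')
    (fun y _ => hu y) (fun y _ => hd y) (hmul hg') ?_ (hmul hg)
  · rw [key]
    have : ∀ y : ℝ, Complex.exp ((L * y : ℝ) * Complex.I) * (L * Complex.I) * g y
        = (L * Complex.I) * (Complex.exp ((L * y : ℝ) * Complex.I) * g y) := fun y => by ring
    simp_rw [this]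
    rw [integral_const_mul, norm_neg, norm_mul, norm_mul, Complex.norm_I, mul_one,
      Complex.norm_real, Real.norm_of_nonneg hL.le, ← mul_assoc, one_div_mul_cancel hL.ne', one_mul]
  · have := (hmul hg).const_mul (L * Complex.I)
    refine this.congr (Filter.Eventually.of_forall fun y => ?_)
    simp only [Pi.mul_apply]
    ring

/-- The Riesz kernel `u ↦ (1 - u)₊`. -/
noncomputable def rieszKernel (u : ℝ) : ℂ := ((max (1 - u) 0 : ℝ) : ℂ)

lemma hasMellin_rieszKernel {s : ℂ} (hs : 0 < s.re) :
    HasMellin rieszKernel s (1 / (s * (s + 1))) := by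
  have h0 : s ≠ 0 := by rintro rfl; simp at hs
  have h1 : s + 1 ≠ 0 := by
    intro h
    have := congrArg Complex.re h
    simp at this
    linarith
  have h2 := hasMellin_one_Ioc hs
  have h3 := hasMellin_cpow_Ioc (s := s) 1 (by simp; linarith)
  have h4 := hasMellin_sub h2.1 h3.1
  rw [h2.2, h3.2, show 1 / s - 1 / (s + 1) = 1 / (s * (s + 1)) by field_simp; ring] at h4
  have hEq : ∀ t ∈ Set.Ioi (0 : ℝ),
      (t : ℂ) ^ (s - 1) • (Set.indicator (Set.Ioc 0 1) (fun _ => (1 : ℂ)) t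
        - Set.indicator (Set.Ioc 0 1) (fun t : ℝ => (t : ℂ) ^ (1 : ℂ)) t)
      = (t : ℂ) ^ (s - 1) • rieszKernel t := by
    intro t ht
    congr 1
    rcases le_or_gt t 1 with h | h
    · have : t ∈ Set.Ioc (0 : ℝ) 1 := ⟨ht, h⟩
      rw [Set.indicator_of_mem this, Set.indicator_of_mem this, Complex.cpow_one, rieszKernel,
        max_eq_left (by linarith)]
      push_cast
      rfl
    · have : t ∉ Set.Ioc (0 : ℝ) 1 := fun h' => by linarith [h'.2]
      rw [Set.indicator_of_notMem this, Set.indicator_of_notMem this, rieszKernel,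
        max_eq_right (by linarith)]
      simp
  refine ⟨?_, ?_⟩
  · exact h4.1.congr_fun hEq measurableSet_Ioi
  · rw [← h4.2]
    exact (MeasureTheory.setIntegral_congr_fun measurableSet_Ioi hEq).symm

lemma norm_one_div_mul_add_one_le {σ : ℝ} (hσ : 1 ≤ σ) (y : ℝ) :
    ‖1 / (((σ : ℂ) + y * Complex.I) * ((σ : ℂ) + y * Complex.I + 1))‖ ≤ (1 + y ^ 2)⁻¹ := by
  have h1 : ∀ a : ℝ, 1 ≤ a → Real.sqrt (1 + y ^ 2) ≤ ‖(a : ℂ) + y * Complex.I‖ := by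
    intro a ha
    rw [Complex.norm_add_mul_I]
    exact Real.sqrt_le_sqrt (by nlinarith)
  have h2 := h1 σ hσ
  have h3 := h1 (σ + 1) (by linarith)
  rw [show ((σ + 1 : ℝ) : ℂ) + y * Complex.I = σ + y * Complex.I + 1 by push_cast; ring] at h3
  rw [norm_div, norm_one, norm_mul, one_div]
  have h4 : 0 < 1 + y ^ 2 := by positivity
  refine inv_anti₀ h4 ?_
  calc 1 + y ^ 2 = Real.sqrt (1 + y ^ 2) * Real.sqrt (1 + y ^ 2) :=
        (Real.mul_self_sqrt h4.le).symm
    _ ≤ _ := by gcongr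

lemma add_mul_I_ne_zero {σ : ℝ} (hσ : 0 < σ) (y : ℝ) : (σ : ℂ) + y * Complex.I ≠ 0 := by
  intro h
  have := congrArg Complex.re h
  simp at this
  linarith

lemma integrable_one_div_mul_add_one {σ : ℝ} (hσ : 1 ≤ σ) :
    MeasureTheory.Integrable fun y : ℝ =>
      1 / (((σ : ℂ) + y * Complex.I) * ((σ : ℂ) + y * Complex.I + 1)) := by
  refine integrable_inv_one_add_sq.mono' ?_
    (Filter.Eventually.of_forall (norm_one_div_mul_add_one_le hσ))
  refine Continuous.aestronglyMeasurable ?_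
  refine continuous_const.div (by fun_prop) fun y =>
    mul_ne_zero (add_mul_I_ne_zero (by linarith) y) ?_
  have := add_mul_I_ne_zero (show 0 < σ + 1 by linarith) y
  rwa [show ((σ + 1 : ℝ) : ℂ) + y * Complex.I = σ + y * Complex.I + 1 by push_cast; ring] at this

lemma rieszKernel_eq_integral {σ : ℝ} (hσ : 1 ≤ σ) {u : ℝ} (hu : 0 < u) :
    rieszKernel u = (1 / (2 * Real.pi) : ℝ) * ∫ y : ℝ, (u : ℂ) ^ (-((σ : ℂ) + y * Complex.I))
      * (1 / (((σ : ℂ) + y * Complex.I) * ((σ : ℂ) + y * Complex.I + 1))) := by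
  have hre : ∀ y : ℝ, 0 < ((σ : ℂ) + y * Complex.I).re := fun y => by simp; linarith
  have h1 := mellinInv_mellin_eq σ rieszKernel hu
    (by simpa using (hasMellin_rieszKernel (s := (σ : ℂ)) (by simp; linarith)).1) ?_ ?_
  · rw [← h1, mellinInv]
    simp_rw [(hasMellin_rieszKernel (hre _)).2, smul_eq_mul]
    rw [Complex.real_smul]
  · refine (integrable_one_div_mul_add_one hσ).congr (Filter.Eventually.of_forall fun y => ?_)
    exact (hasMellin_rieszKernel (hre y)).2.symm
  · unfold rieszKernel
    fun_prop

open LSeries in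
lemma hasSum_rieszKernel {c : ℕ → ℂ} {σ x : ℝ} (hσ : 1 ≤ σ) (hx : 0 < x)
    (hc : LSeriesSummable c (σ : ℂ)) :
    HasSum (fun n : ℕ => if n = 0 then 0 else c n * rieszKernel (n / x))
      ((1 / (2 * Real.pi) : ℝ) * ∫ y : ℝ, (x : ℂ) ^ ((σ : ℂ) + y * Complex.I)
        * (LSeries c ((σ : ℂ) + y * Complex.I)
          * (1 / (((σ : ℂ) + y * Complex.I) * ((σ : ℂ) + y * Complex.I + 1))))) := by
  set s : ℝ → ℂ := fun y => (σ : ℂ) + y * Complex.I with hs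
  set M : ℝ → ℂ := fun y => 1 / (s y * (s y + 1)) with hM
  have hxne : (x : ℂ) ≠ 0 := Complex.ofReal_ne_zero.mpr hx.ne'
  have hMint : MeasureTheory.Integrable M := integrable_one_div_mul_add_one hσ
  set F : ℕ → ℝ → ℂ := fun n y => (x : ℂ) ^ s y * (term c (s y) n * M y) with hF
  have hnormF : ∀ n y, ‖F n y‖ = x ^ σ * ‖term c (σ : ℂ) n‖ * ‖M y‖ := by
    intro n y
    simp only [hF, norm_mul, Complex.norm_cpow_eq_rpow_re_of_pos hx]
    have e1 : (s y).re = σ := by simp [hs]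
    have e2 : ‖term c (s y) n‖ = ‖term c (σ : ℂ) n‖ := by
      rw [norm_term_eq, norm_term_eq, e1, Complex.ofReal_re]
    rw [e1, e2]
    ring
  have hcont : ∀ n, Continuous fun y => (x : ℂ) ^ s y * term c (s y) n := by
    intro n
    refine Continuous.mul (Continuous.const_cpow (by fun_prop) (Or.inl hxne)) ?_
    rcases eq_or_ne n 0 with rfl | hn
    · simpa using continuous_const
    · have : (n : ℂ) ≠ 0 := Nat.cast_ne_zero.mpr hn
      simp_rw [term_of_ne_zero hn]
      exact continuous_const.div (Continuous.const_cpow (by fun_prop) (Or.inl this))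
        fun y => by simp [Complex.cpow_eq_zero_iff, this]
  have hFint : ∀ n, MeasureTheory.Integrable (F n) := by
    intro n
    have h1 : F n = fun y => ((x : ℂ) ^ s y * term c (s y) n) * M y := by
      ext y; simp only [hF]; ring
    refine (hMint.norm.const_mul (x ^ σ * ‖term c (σ : ℂ) n‖)).mono' ?_
      (Filter.Eventually.of_forall fun y => (hnormF n y).le)
    rw [h1]
    exact (hcont n).aestronglyMeasurable.mul hMint.aestronglyMeasurable
  have hsum : Summable fun n => ∫ y, ‖F n y‖ := by
    simp_rw [hnormF, MeasureTheory.integral_const_mul]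
    exact (hc.norm.mul_left _).mul_right _
  have h1 := (MeasureTheory.hasSum_integral_of_summable_integral_norm hFint hsum).mul_left
    (((1 / (2 * Real.pi) : ℝ)) : ℂ)
  have h2 : ∀ y, ∑' n, F n y = (x : ℂ) ^ s y * (LSeries c (s y) * M y) := by
    intro y
    simp only [hF]
    rw [tsum_mul_left, tsum_mul_right]
    rfl
  simp_rw [h2] at h1
  have h3 : (fun n : ℕ => if n = 0 then 0 else c n * rieszKernel (n / x))
      = fun n => ((1 / (2 * Real.pi) : ℝ) : ℂ) * ∫ y, F n y := by
    ext n
    split_ifs with hn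
    · simp [hF, hn]
    · have hn0 : (0 : ℝ) < n := Nat.cast_pos.mpr (Nat.pos_of_ne_zero hn)
      have hnne : (n : ℂ) ≠ 0 := Nat.cast_ne_zero.mpr hn
      rw [rieszKernel_eq_integral hσ (div_pos hn0 hx), mul_left_comm,
        ← MeasureTheory.integral_const_mul]
      congr 2
      ext y
      simp only [hF, term_of_ne_zero hn]
      change c n * (((n / x : ℝ) : ℂ) ^ (-(s y)) * M y) = _
      rw [Complex.cpow_neg, Complex.ofReal_div, Complex.div_cpow_ofReal_nonneg hn0.le hx.le]
      have e1 : ((n : ℝ) : ℂ) ^ s y ≠ 0 := by simp [Complex.cpow_eq_zero_iff, hnne]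
      have e2 : (x : ℂ) ^ s y ≠ 0 := by simp [Complex.cpow_eq_zero_iff, hxne]
      rw [Complex.ofReal_natCast] at e1 ⊢
      field_simp
  rw [h3]
  exact h1

lemma hasDerivAt_iteratedDeriv_perronZeta (n : ℕ) {σ : ℝ} (hσ : 1 < σ) (y : ℝ) :
    HasDerivAt
      (fun y : ℝ => Complex.I ^ n * iteratedDeriv n perronZeta ((σ : ℂ) + y * Complex.I))
      (Complex.I ^ (n + 1) * iteratedDeriv (n + 1) perronZeta ((σ : ℂ) + y * Complex.I)) y := by
  have h1 : AnalyticAt ℂ (iteratedDeriv n perronZeta) ((σ : ℂ) + y * Complex.I) := by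
    rw [iteratedDeriv_eq_iterate]
    exact AnalyticAt.iterated_deriv (analyticAt_perronZeta (by simpa using hσ.le)) n
  have h2 := h1.differentiableAt.hasDerivAt
  rw [← iteratedDeriv_succ] at h2
  have h3 : HasDerivAt (fun y : ℝ => (σ : ℂ) + y * Complex.I) Complex.I y := by
    have := ((hasDerivAt_id y).ofReal_comp.mul_const Complex.I).const_add (σ : ℂ)
    simpa using this
  have h4 := (h2.comp y h3).const_mul (Complex.I ^ n)
  rw [mul_comm _ Complex.I, ← mul_assoc, ← pow_succ] at h4
  exact h4

lemma exists_norm_integral_exp_mul_perronZeta_le :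
    ∃ C, 0 < C ∧ ∀ σ : ℝ, 1 < σ → σ ≤ 2 → ∀ L : ℝ, 0 < L →
      ‖∫ y : ℝ, Complex.exp ((L * y : ℝ) * Complex.I) * perronZeta ((σ : ℂ) + y * Complex.I)‖
        ≤ C / L ^ 2 := by
  obtain ⟨K, hK, hbound⟩ := exists_norm_iteratedDeriv_perronZeta_le
  have hint : MeasureTheory.Integrable fun y : ℝ => K * (1 + y ^ 2) ^ (-(3 / 4) : ℝ) := by
    have := integrable_rpow_neg_one_add_norm_sq (E := ℝ) (r := 3 / 2)
      (μ := MeasureTheory.volume) (by norm_num)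
    refine (this.const_mul K).congr (Filter.Eventually.of_forall fun y => ?_)
    simp only [Real.norm_eq_abs, sq_abs]
    norm_num
  set J : ℝ := ∫ y : ℝ, K * (1 + y ^ 2) ^ (-(3 / 4) : ℝ) with hJ
  have hJ0 : 0 ≤ J := MeasureTheory.integral_nonneg fun y => by positivity
  refine ⟨J + 1, by linarith, fun σ hσ hσ2 L hL => ?_⟩
  set G : ℕ → ℝ → ℂ := fun n y =>
    Complex.I ^ n * iteratedDeriv n perronZeta ((σ : ℂ) + y * Complex.I) with hG
  have hGd : ∀ n y, HasDerivAt (G n) (G (n + 1) y) y := fun n y =>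
    hasDerivAt_iteratedDeriv_perronZeta n hσ y
  have hGb : ∀ n ≤ 2, ∀ y, ‖G n y‖ ≤ K * (1 + y ^ 2) ^ (-(3 / 4) : ℝ) := by
    intro n hn y
    have := hbound n hn ((σ : ℂ) + y * Complex.I) (by simpa using hσ) (by simpa using hσ2)
    simpa [hG] using this
  have hGi : ∀ n ≤ 2, MeasureTheory.Integrable (G n) := fun n hn =>
    hint.mono' (continuous_iff_continuousAt.mpr fun y =>
      (hGd n y).continuousAt).aestronglyMeasurable (Filter.Eventually.of_forall (hGb n hn))
  have h0 : ∀ y : ℝ, perronZeta ((σ : ℂ) + y * Complex.I) = G 0 y := fun y => by simp [hG]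
  simp_rw [h0]
  rw [norm_integral_exp_mul_eq hL (hGd 0) (hGi 0 (by norm_num)) (hGi 1 (by norm_num)),
    norm_integral_exp_mul_eq hL (hGd 1) (hGi 1 (by norm_num)) (hGi 2 (by norm_num))]
  have h2 : ‖∫ y : ℝ, Complex.exp ((L * y : ℝ) * Complex.I) * G (1 + 1) y‖ ≤ J := by
    refine MeasureTheory.norm_integral_le_of_norm_le hint (Filter.Eventually.of_forall fun y => ?_)
    rw [norm_mul, Complex.norm_exp_ofReal_mul_I, one_mul]
    exact hGb 2 le_rfl y
  calc _ ≤ 1 / L * (1 / L * (J + 1)) := by gcongr; linarith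
    _ = (J + 1) / L ^ 2 := by field_simp

lemma LSeriesSummable_vonMangoldt_sub_one {s : ℂ} (hs : 1 < s.re) :
    LSeriesSummable (fun n => (ArithmeticFunction.vonMangoldt n : ℂ) - 1) s :=
  LSeriesSummable.sub (ArithmeticFunction.LSeriesSummable_vonMangoldt hs)
    (LSeriesSummable_one_iff.mpr hs)

lemma LSeries_vonMangoldt_sub_one_mul {s : ℂ} (hs : 1 < s.re) :
    LSeries (fun n => (ArithmeticFunction.vonMangoldt n : ℂ) - 1) s * (1 / (s * (s + 1)))
      = perronZeta s := by
  have h1 : LSeries (fun n => (ArithmeticFunction.vonMangoldt n : ℂ) - 1) s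
      = -deriv riemannZeta s / riemannZeta s - riemannZeta s := by
    rw [← ArithmeticFunction.LSeries_vonMangoldt_eq_deriv_riemannZeta_div hs,
      ← LSeries_one_eq_riemannZeta hs]
    exact LSeries_sub (ArithmeticFunction.LSeriesSummable_vonMangoldt hs)
      (LSeriesSummable_one_iff.mpr hs)
  rw [h1, perronZeta_eq (by rintro rfl; simp at hs) (riemannZeta_ne_zero_of_one_lt_re hs)]

/-- The Riesz mean of `Λ - 1` saves two logarithms. -/
lemma exists_abs_sum_vonMangoldt_sub_one_mul_le :
    ∃ C, 0 < C ∧ ∀ x : ℝ, Real.exp 1 ≤ x →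
      |∑ n ∈ Ioc 0 ⌊x⌋₊, (ArithmeticFunction.vonMangoldt n - 1) * (1 - n / x)|
        ≤ C * x / Real.log x ^ 2 := by
  obtain ⟨C, hC, hbound⟩ := exists_norm_integral_exp_mul_perronZeta_le
  refine ⟨Real.exp 1 * C, by positivity, fun x hx => ?_⟩
  have hx0 : 0 < x := (Real.exp_pos 1).trans_le hx
  have hL : 1 ≤ Real.log x := (Real.le_log_iff_exp_le hx0).mpr hx
  set L := Real.log x with hLdef
  set σ : ℝ := 1 + 1 / L with hσdef
  have hL0 : 0 < L := by linarith
  have hσ : 1 < σ := by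
    have : 0 < 1 / L := by positivity
    linarith
  have hσ2 : σ ≤ 2 := by
    have : 1 / L ≤ 1 := by rw [div_le_one hL0]; exact hL
    linarith
  have hre : ∀ y : ℝ, 1 < ((σ : ℂ) + y * Complex.I).re := fun y => by simpa using hσ
  have hxσ : x ^ σ = Real.exp 1 * x := by
    rw [Real.rpow_def_of_pos hx0, ← hLdef, hσdef, mul_add, mul_one, mul_one_div_cancel hL0.ne',
      Real.exp_add, hLdef, Real.exp_log hx0, mul_comm]
  have h1 := hasSum_rieszKernel (x := x) hσ.le hx0
    (LSeriesSummable_vonMangoldt_sub_one (s := (σ : ℂ)) (by simpa using hσ))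
  have h2 : ∀ y : ℝ, (x : ℂ) ^ ((σ : ℂ) + y * Complex.I)
      = (x ^ σ : ℝ) * Complex.exp ((L * y : ℝ) * Complex.I) := by
    intro y
    rw [Complex.cpow_add _ _ (Complex.ofReal_ne_zero.mpr hx0.ne'), Complex.ofReal_cpow hx0.le,
      Complex.cpow_def_of_ne_zero (Complex.ofReal_ne_zero.mpr hx0.ne') (y * Complex.I),
      ← Complex.ofReal_log hx0.le, ← hLdef]
    push_cast
    ring_nf
  have h3 : HasSum (fun n : ℕ => if n = 0 then (0 : ℂ) else
      ((ArithmeticFunction.vonMangoldt n : ℂ) - 1) * rieszKernel (n / x))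
      (∑ n ∈ Ioc 0 ⌊x⌋₊, ((ArithmeticFunction.vonMangoldt n : ℂ) - 1) * (1 - n / x)) := by
    have h4 := hasSum_sum_of_ne_finset_zero (L := .unconditional ℕ) (s := Ioc 0 ⌊x⌋₊)
      (f := fun n : ℕ =>
      if n = 0 then (0 : ℂ) else
        ((ArithmeticFunction.vonMangoldt n : ℂ) - 1) * rieszKernel (n / x)) ?_
    · rw [Finset.sum_congr rfl fun n hn => ?_]
      · exact h4
      rw [Finset.mem_Ioc] at hn
      have : (n : ℝ) / x ≤ 1 := by
        rw [div_le_one hx0]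
        exact (Nat.le_floor_iff hx0.le).mp hn.2
      rw [if_neg (by omega), rieszKernel, max_eq_left (by linarith)]
      push_cast
      rfl
    · intro n hn
      split_ifs with h
      · rfl
      · have : ⌊x⌋₊ < n := by
          by_contra h'
          exact hn (Finset.mem_Ioc.mpr ⟨Nat.pos_of_ne_zero h, by omega⟩)
        have : 1 ≤ (n : ℝ) / x := by
          rw [one_le_div hx0]
          exact ((Nat.floor_lt hx0.le).mp this).le
        rw [rieszKernel, max_eq_right (by linarith)]
        simp
  have h5 := h3.unique h1
  simp_rw [LSeries_vonMangoldt_sub_one_mul (hre _), h2, mul_assoc] at h5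
  rw [MeasureTheory.integral_const_mul] at h5
  have h6 : ((∑ n ∈ Ioc 0 ⌊x⌋₊, (ArithmeticFunction.vonMangoldt n - 1) * (1 - n / x) : ℝ) : ℂ)
      = ∑ n ∈ Ioc 0 ⌊x⌋₊, ((ArithmeticFunction.vonMangoldt n : ℂ) - 1) * (1 - n / x) := by
    push_cast
    rfl
  rw [← Real.norm_eq_abs, ← Complex.norm_real, h6, h5, norm_mul, norm_mul, Complex.norm_real,
    Complex.norm_real, hxσ, Real.norm_of_nonneg (by positivity),
    Real.norm_of_nonneg (by positivity)]
  have h7 : 1 / (2 * Real.pi) ≤ 1 := by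
    rw [div_le_one (by positivity)]
    linarith [Real.pi_gt_three]
  calc _ ≤ 1 * (Real.exp 1 * x * (C / L ^ 2)) := by
        gcongr
        exact hbound σ hσ hσ2 L hL0
    _ = _ := by ring

/-- The integral `∫₀ˣ ψ`, written as a Riesz sum. -/
noncomputable def psiRiesz (x : ℝ) : ℝ :=
  ∑ n ∈ Ioc 0 ⌊x⌋₊, ArithmeticFunction.vonMangoldt n * (x - n)

lemma sum_vonMangoldt_mul_sub_le_psiRiesz {u : ℝ} (hu : 0 ≤ u) (m : ℕ) :
    ∑ n ∈ Ioc 0 m, ArithmeticFunction.vonMangoldt n * (u - n) ≤ psiRiesz u := by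
  have h1 : ∀ n : ℕ, n ∉ Ioc 0 ⌊u⌋₊ → n ∈ Ioc 0 m → u - n ≤ 0 := by
    intro n hn hm
    rw [Finset.mem_Ioc] at hn hm
    have : ⌊u⌋₊ < n := by omega
    linarith [(Nat.floor_lt hu).mp this]
  have h2 : ∀ n : ℕ, n ∈ Ioc 0 ⌊u⌋₊ → 0 ≤ u - n := by
    intro n hn
    rw [Finset.mem_Ioc] at hn
    linarith [(Nat.le_floor_iff hu).mp hn.2]
  rw [psiRiesz, ← Finset.sum_inter_add_sum_sdiff (Ioc 0 m) (Ioc 0 ⌊u⌋₊)]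
  have h3 : ∑ n ∈ Ioc 0 m \ Ioc 0 ⌊u⌋₊, ArithmeticFunction.vonMangoldt n * (u - n) ≤ 0 := by
    refine Finset.sum_nonpos fun n hn => ?_
    rw [Finset.mem_sdiff] at hn
    exact mul_nonpos_of_nonneg_of_nonpos ArithmeticFunction.vonMangoldt_nonneg (h1 n hn.2 hn.1)
  have h4 : ∑ n ∈ Ioc 0 m ∩ Ioc 0 ⌊u⌋₊, ArithmeticFunction.vonMangoldt n * (u - n)
      ≤ ∑ n ∈ Ioc 0 ⌊u⌋₊, ArithmeticFunction.vonMangoldt n * (u - n) :=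
    Finset.sum_le_sum_of_subset_of_nonneg Finset.inter_subset_right fun n hn _ =>
      mul_nonneg ArithmeticFunction.vonMangoldt_nonneg (h2 n hn)
  linarith

lemma psiRiesz_add_mul_psi_le {x h : ℝ} (hu : 0 ≤ x + h) :
    psiRiesz x + h * Chebyshev.psi x ≤ psiRiesz (x + h) := by
  refine le_trans (le_of_eq ?_) (sum_vonMangoldt_mul_sub_le_psiRiesz hu ⌊x⌋₊)
  rw [psiRiesz, Chebyshev.psi, Finset.mul_sum, ← Finset.sum_add_distrib]
  exact Finset.sum_congr rfl fun n _ => by ring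

lemma sum_Ioc_sub_cast (x : ℝ) (N : ℕ) :
    ∑ n ∈ Ioc 0 N, (x - n) = N * x - N * (N + 1) / 2 := by
  induction N with
  | zero => simp
  | succ k ih =>
    rw [Finset.sum_Ioc_succ_top (Nat.zero_le k), ih]
    push_cast
    ring

lemma abs_sum_Ioc_floor_sub_cast_sub_le {x : ℝ} (hx : 1 ≤ x) :
    |∑ n ∈ Ioc 0 ⌊x⌋₊, (x - n) - x ^ 2 / 2| ≤ x := by
  have h1 := Nat.floor_le (show 0 ≤ x by linarith)
  have h2 := Nat.lt_floor_add_one x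
  rw [sum_Ioc_sub_cast, abs_le]
  constructor <;> nlinarith

lemma exists_abs_psiRiesz_sub_le :
    ∃ C, 0 < C ∧ ∀ x : ℝ, Real.exp 1 ≤ x →
      |psiRiesz x - x ^ 2 / 2| ≤ C * (x ^ 2 / Real.log x ^ 2) := by
  obtain ⟨C, hC, hbound⟩ := exists_abs_sum_vonMangoldt_sub_one_mul_le
  refine ⟨C + 4, by positivity, fun x hx => ?_⟩
  have hx1 : 1 ≤ x := (Real.one_le_exp zero_le_one).trans hx
  have hx0 : 0 < x := by linarith
  have hL : 1 ≤ Real.log x := (Real.le_log_iff_exp_le hx0).mpr hx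
  have h1 := hbound x hx
  have h2 : psiRiesz x - ∑ n ∈ Ioc 0 ⌊x⌋₊, (x - n)
      = x * ∑ n ∈ Ioc 0 ⌊x⌋₊, (ArithmeticFunction.vonMangoldt n - 1) * (1 - n / x) := by
    rw [psiRiesz, Finset.mul_sum, ← Finset.sum_sub_distrib]
    exact Finset.sum_congr rfl fun n _ => by field_simp
  have h3 : |psiRiesz x - ∑ n ∈ Ioc 0 ⌊x⌋₊, (x - n)| ≤ C * (x ^ 2 / Real.log x ^ 2) := by
    rw [h2, abs_mul, abs_of_pos hx0]
    calc _ ≤ x * (C * x / Real.log x ^ 2) := by gcongr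
      _ = _ := by ring
  have h4 : x ≤ 4 * (x ^ 2 / Real.log x ^ 2) := by
    have h5 : Real.log x ≤ 2 * Real.sqrt x := by
      have := Real.log_le_rpow_div hx0.le (show (0 : ℝ) < 1 / 2 by norm_num)
      rw [← Real.sqrt_eq_rpow] at this
      linarith
    rw [mul_div_assoc', le_div_iff₀ (by positivity)]
    have h6 : Real.log x ^ 2 ≤ 4 * x := by
      calc Real.log x ^ 2 ≤ (2 * Real.sqrt x) ^ 2 := by gcongr
        _ = 4 * x := by rw [mul_pow, Real.sq_sqrt hx0.le]; norm_num
    nlinarith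
  have h5 := abs_sum_Ioc_floor_sub_cast_sub_le hx1
  calc |psiRiesz x - x ^ 2 / 2| ≤ |psiRiesz x - ∑ n ∈ Ioc 0 ⌊x⌋₊, (x - n)|
        + |∑ n ∈ Ioc 0 ⌊x⌋₊, (x - n) - x ^ 2 / 2| := abs_sub_le _ _ _
    _ ≤ C * (x ^ 2 / Real.log x ^ 2) + 4 * (x ^ 2 / Real.log x ^ 2) := by linarith
    _ = _ := by ring

/-- The prime number theorem with error term `O(x / log x)`, for `ψ`. -/
lemma exists_abs_psi_sub_le :
    ∃ C, 0 < C ∧ ∀ x : ℝ, Real.exp 2 ≤ x → |Chebyshev.psi x - x| ≤ C * (x / Real.log x) := by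
  obtain ⟨C, hC, hbound⟩ := exists_abs_psiRiesz_sub_le
  refine ⟨5 * C + 1, by positivity, fun x hx => ?_⟩
  have he : Real.exp 2 = Real.exp 1 * Real.exp 1 := by rw [← Real.exp_add]; norm_num
  have he2 : 2 ≤ Real.exp 1 := by linarith [Real.add_one_le_exp 1]
  have hx0 : 0 < x := (Real.exp_pos 2).trans_le hx
  have hL : 2 ≤ Real.log x := (Real.le_log_iff_exp_le hx0).mpr hx
  have hx2e : 2 * Real.exp 1 ≤ x := by nlinarith
  set L := Real.log x with hLdef
  have hL0 : 0 < L := by linarith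
  set h := x / L with hh
  have hh0 : 0 < h := by positivity
  have hhx : h ≤ x / 2 := by rw [hh]; gcongr
  have hD : x ^ 2 / L ^ 2 = h ^ 2 := by rw [hh, div_pow]
  have hxL : x * h = h ^ 2 * L := by rw [hh]; field_simp
  have b0 := hbound x (by linarith)
  rw [← hLdef, hD] at b0
  have b1 : |psiRiesz (x + h) - (x + h) ^ 2 / 2| ≤ C * (4 * h ^ 2) := by
    refine (hbound (x + h) (by linarith)).trans ?_
    have : L ≤ Real.log (x + h) := Real.log_le_log hx0 (by linarith)
    rw [← hD]
    gcongr
    calc (x + h) ^ 2 / Real.log (x + h) ^ 2 ≤ (2 * x) ^ 2 / L ^ 2 := by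
          gcongr
          linarith
      _ = 4 * (x ^ 2 / L ^ 2) := by ring
  have b2 : |psiRiesz (x - h) - (x - h) ^ 2 / 2| ≤ C * (4 * h ^ 2) := by
    refine (hbound (x - h) (by linarith)).trans ?_
    have : L / 2 ≤ Real.log (x - h) := by
      have h1 : Real.log (x / 2) ≤ Real.log (x - h) :=
        Real.log_le_log (by linarith) (by linarith)
      rw [Real.log_div hx0.ne' (by norm_num)] at h1
      linarith [Real.log_two_lt_d9]
    have hxh : 0 ≤ x - h := by linarith
    rw [← hD]
    gcongr
    calc (x - h) ^ 2 / Real.log (x - h) ^ 2 ≤ x ^ 2 / (L / 2) ^ 2 := by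
          gcongr
          linarith
      _ = 4 * (x ^ 2 / L ^ 2) := by field_simp; norm_num
  have c1 := psiRiesz_add_mul_psi_le (x := x) (h := h) (by linarith)
  have c2 := psiRiesz_add_mul_psi_le (x := x) (h := -h) (by linarith)
  rw [← sub_eq_add_neg] at c2
  rw [abs_le] at b0 b1 b2 ⊢
  constructor
  · refine le_of_mul_le_mul_left ?_ hh0
    nlinarith
  · refine le_of_mul_le_mul_left ?_ hh0
    nlinarith

/-- The prime number theorem with error term `O(x / log x)`, for `θ`. -/
lemma exists_abs_theta_sub_le :
    ∃ C, 0 < C ∧ ∀ x : ℝ, Real.exp 2 ≤ x → |Chebyshev.theta x - x| ≤ C * (x / Real.log x) := by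
  obtain ⟨C, hC, hbound⟩ := exists_abs_psi_sub_le
  refine ⟨C + 32, by positivity, fun x hx => ?_⟩
  have hx0 : 0 < x := (Real.exp_pos 2).trans_le hx
  have hL : 2 ≤ Real.log x := (Real.le_log_iff_exp_le hx0).mpr hx
  have hL0 : 0 < Real.log x := by linarith
  have hx1 : 1 ≤ x := (Real.one_le_exp (by norm_num)).trans hx
  have h1 := Chebyshev.abs_psi_sub_theta_le_sqrt_mul_log hx1
  have h2 : 2 * Real.sqrt x * Real.log x ≤ 32 * (x / Real.log x) := by
    have h5 : Real.log x ≤ 4 * x ^ (1 / 4 : ℝ) := by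
      have := Real.log_le_rpow_div hx0.le (show (0 : ℝ) < 1 / 4 by norm_num)
      linarith
    have h6 : Real.log x ^ 2 ≤ 16 * Real.sqrt x := by
      calc Real.log x ^ 2 ≤ (4 * x ^ (1 / 4 : ℝ)) ^ 2 := by gcongr
        _ = 16 * Real.sqrt x := by
          rw [mul_pow, ← Real.rpow_natCast, ← Real.rpow_natCast, ← Real.rpow_mul hx0.le,
            Real.sqrt_eq_rpow]
          norm_num
    rw [mul_div_assoc', le_div_iff₀ hL0]
    have h7 := Real.mul_self_sqrt hx0.le
    nlinarith [Real.sqrt_nonneg x]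
  calc |Chebyshev.theta x - x| ≤ |Chebyshev.theta x - Chebyshev.psi x| + |Chebyshev.psi x - x| :=
        abs_sub_le _ _ _
    _ ≤ 32 * (x / Real.log x) + C * (x / Real.log x) := by
        rw [abs_sub_comm (Chebyshev.theta x)]
        exact add_le_add (h1.trans h2) (hbound x hx)
    _ = _ := by ring

open MeasureTheory in
/-- Sums of `log p * p ^ (-(c + 1))` over primes in `(y, Y]`. -/
lemma exists_abs_sum_log_mul_rpow_sub_le {c : ℝ} (hc : 0 < c) :
    ∃ K, 0 < K ∧ ∀ y Y : ℝ, Real.exp 2 ≤ y → y ≤ Y →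
      |∑ p ∈ Ioc ⌊y⌋₊ ⌊Y⌋₊ with p.Prime, (p : ℝ) ^ (-(c + 1)) * Real.log p
        - (y ^ (-c) - Y ^ (-c)) / c| ≤ K * (y ^ (-c) / Real.log y) := by
  obtain ⟨C, hC, hbound⟩ := exists_abs_theta_sub_le
  refine ⟨C * (2 + (c + 1) / c), by positivity, fun y Y hy hyY => ?_⟩
  have hy0 : 0 < y := (Real.exp_pos 2).trans_le hy
  have hY0 : 0 < Y := by linarith
  have hL : 2 ≤ Real.log y := (Real.le_log_iff_exp_le hy0).mpr hy
  have hL0 : 0 < Real.log y := by linarith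
  have hpos : ∀ t ∈ Set.Icc y Y, 0 < t := fun t ht => hy0.trans_le ht.1
  set f : ℝ → ℝ := fun t => t ^ (-(c + 1)) with hf
  have hfd : ∀ t, 0 < t → HasDerivAt f (-(c + 1) * t ^ (-(c + 1) - 1)) t := fun t ht =>
    Real.hasDerivAt_rpow_const (Or.inl ht.ne')
  have hfc : ContinuousOn (fun t : ℝ => -(c + 1) * t ^ (-(c + 1) - 1)) (Set.Icc y Y) :=
    continuousOn_const.mul (continuousOn_id.rpow_const fun t ht => Or.inl (hpos t ht).ne')
  have hfi : IntegrableOn (deriv f) (Set.Icc y Y) :=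
    (hfc.integrableOn_Icc).congr_fun (fun t ht => (hfd t (hpos t ht)).deriv.symm) measurableSet_Icc
  set a : ℕ → ℝ := fun k => if k.Prime then Real.log k else 0 with ha
  have hθ : ∀ t : ℝ, ∑ k ∈ Icc 0 ⌊t⌋₊, a k = Chebyshev.theta t := by
    intro t
    rw [Chebyshev.theta_eq_sum_Icc, Finset.sum_filter]
  have habel := sum_mul_eq_sub_sub_integral_mul a hy0.le hyY
    (fun t ht => (hfd t (hpos t ht)).differentiableAt) hfi
  have hprod := integrableOn_mul_sum_Icc (m := 0) a hy0.le hfi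
  simp_rw [hθ] at habel hprod
  have hsum : ∑ p ∈ Ioc ⌊y⌋₊ ⌊Y⌋₊ with p.Prime, (p : ℝ) ^ (-(c + 1)) * Real.log p
      = ∑ k ∈ Ioc ⌊y⌋₊ ⌊Y⌋₊, f k * a k := by
    rw [Finset.sum_filter]
    refine Finset.sum_congr rfl fun k _ => ?_
    simp only [ha, hf, mul_ite, mul_zero]
  have hmul : ∀ t, 0 < t → f t * t = t ^ (-c) := by
    intro t ht
    simp only [hf]
    rw [← Real.rpow_add_one ht.ne']
    ring_nf
  have hmul' : ∀ t : ℝ, 0 < t → t ^ (-(c + 1) - 1) * t = t ^ (-c - 1) := by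
    intro t ht
    rw [← Real.rpow_add_one ht.ne']
    ring_nf
  have hint : ∫ t in Set.Ioc y Y, t ^ (-c - 1) = (y ^ (-c) - Y ^ (-c)) / c := by
    rw [← intervalIntegral.integral_of_le hyY, integral_rpow]
    · rw [sub_add_cancel, div_neg, ← neg_div, neg_sub]
    · refine Or.inr ⟨by linarith, ?_⟩
      rw [Set.uIcc_of_le hyY]
      exact fun h => (hpos 0 h).ne' rfl
  have hci : IntegrableOn (fun t : ℝ => t ^ (-c - 1)) (Set.Ioc y Y) :=
    ((continuousOn_id.rpow_const fun t ht =>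
      Or.inl (hpos t ht).ne').integrableOn_Icc).mono_set Set.Ioc_subset_Icc_self
  have hsplit : ∫ t in Set.Ioc y Y, deriv f t * Chebyshev.theta t
      = (∫ t in Set.Ioc y Y, -(c + 1) * t ^ (-c - 1))
        + ∫ t in Set.Ioc y Y, (deriv f t * Chebyshev.theta t - -(c + 1) * t ^ (-c - 1)) := by
    rw [integral_sub (hprod.mono_set Set.Ioc_subset_Icc_self) (hci.const_mul (-(c + 1))),
      add_sub_cancel]
  have herr : |∫ t in Set.Ioc y Y, (deriv f t * Chebyshev.theta t - -(c + 1) * t ^ (-c - 1))|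
      ≤ C / Real.log y * (c + 1) * ((y ^ (-c) - Y ^ (-c)) / c) := by
    rw [← hint, ← integral_const_mul, ← Real.norm_eq_abs]
    refine norm_integral_le_of_norm_le (hci.const_mul _) ?_
    refine (ae_restrict_mem measurableSet_Ioc).mono fun t ht => ?_
    have ht0 : 0 < t := hy0.trans ht.1
    have hlog : Real.log y ≤ Real.log t := Real.log_le_log hy0 ht.1.le
    rw [(hfd t ht0).deriv, ← hmul' t ht0, Real.norm_eq_abs,
      show -(c + 1) * t ^ (-(c + 1) - 1) * Chebyshev.theta t
          - -(c + 1) * (t ^ (-(c + 1) - 1) * t)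
        = -((c + 1) * t ^ (-(c + 1) - 1) * (Chebyshev.theta t - t)) by ring, abs_neg, abs_mul,
      abs_of_pos (by positivity)]
    calc _ ≤ (c + 1) * t ^ (-(c + 1) - 1) * (C * (t / Real.log y)) := by
          gcongr
          refine (hbound t (hy.trans ht.1.le)).trans ?_
          gcongr
      _ = _ := by ring
  have hend : ∀ t, y ≤ t → |f t * Chebyshev.theta t - t ^ (-c)| ≤ C * (y ^ (-c) / Real.log y) := by
    intro t ht
    have ht0 : 0 < t := hy0.trans_le ht
    have hlog : Real.log y ≤ Real.log t := Real.log_le_log hy0 ht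
    rw [← hmul t ht0, ← mul_sub, abs_mul,
      abs_of_pos (show 0 < f t from Real.rpow_pos_of_pos ht0 _)]
    have hanti : t ^ (-c) ≤ y ^ (-c) := Real.rpow_le_rpow_of_nonpos hy0 ht (by linarith)
    calc _ ≤ f t * (C * (t / Real.log y)) := by
          refine mul_le_mul_of_nonneg_left ?_ (Real.rpow_pos_of_pos ht0 _).le
          refine (hbound t (hy.trans ht)).trans ?_
          gcongr
      _ = C * (t ^ (-c) / Real.log y) := by rw [← hmul t ht0]; ring
      _ ≤ _ := by gcongr
  rw [hsum, habel, hsplit, integral_const_mul, hint]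
  have hY : Y ^ (-c) ≥ 0 := by positivity
  have h1 := hend y le_rfl
  have h2 := hend Y hyY
  have h3 : C / Real.log y * (c + 1) * ((y ^ (-c) - Y ^ (-c)) / c)
      ≤ C * ((c + 1) / c) * (y ^ (-c) / Real.log y) := by
    calc _ ≤ C / Real.log y * (c + 1) * (y ^ (-c) / c) := by gcongr; linarith
      _ = _ := by ring
  have h4 : (c + 1) * ((y ^ (-c) - Y ^ (-c)) / c)
      = (y ^ (-c) - Y ^ (-c)) + (y ^ (-c) - Y ^ (-c)) / c := by field_simp
  rw [abs_le] at *
  constructor <;> linarith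

lemma abs_one_div_mul_sq_sub_le {l u : ℝ} (hl : 0 < l) (hu : 0 ≤ u) (hul : u ≤ l / 2) :
    |1 / ((l + u) * (2 * l - u) ^ 2) - 1 / (4 * l ^ 3)| ≤ u / l ^ 4 := by
  have h1 : 0 < l + u := by linarith
  have h2 : l ≤ 2 * l - u := by linarith
  have h3 : 0 < 2 * l - u := by linarith
  have h4 : 1 / ((l + u) * (2 * l - u) ^ 2) - 1 / (4 * l ^ 3)
      = u * (u * (3 * l - u)) / (4 * l ^ 3 * ((l + u) * (2 * l - u) ^ 2)) := by
    rw [div_sub_div _ _ (by positivity) (by positivity)]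
    ring
  have h6 : 0 ≤ u * (3 * l - u) := mul_nonneg hu (by linarith)
  rw [h4, abs_of_nonneg (by positivity)]
  have h5 : 4 * l ^ 3 * (l * l ^ 2) ≤ 4 * l ^ 3 * ((l + u) * (2 * l - u) ^ 2) := by
    gcongr
    linarith
  have h7 : u * (3 * l - u) ≤ 4 * l ^ 2 := by nlinarith
  calc _ ≤ u * (4 * l ^ 2) / (4 * l ^ 3 * (l * l ^ 2)) := by gcongr
    _ = u / l ^ 4 := by field_simp

/-- The asymptotic expansion in terms of `y = x ^ (1 / 3)` and an upper end `Y`. -/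
lemma exists_abs_sum_one_div_sub_le {c : ℝ} (hc : 0 < c) :
    ∃ K, 0 < K ∧ ∀ y Y : ℝ, Real.exp 2 ≤ y → y ≤ Y → Y ≤ y * y ^ (1 / 2 : ℝ) →
      Y ^ (-c) ≤ y ^ (-c) / Real.log y →
      |∑ p ∈ Ioc ⌊y⌋₊ ⌊Y⌋₊ with p.Prime, 1 / ((p : ℝ) ^ (c + 1) * Real.log (y ^ 3 / p) ^ 2)
        - y ^ (-c) / (4 * c * Real.log y ^ 3)| ≤ K * (y ^ (-c) / Real.log y ^ 4) := by
  obtain ⟨K₁, hK₁, hS₁⟩ := exists_abs_sum_log_mul_rpow_sub_le hc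
  obtain ⟨K₂, hK₂, hS₂⟩ := exists_abs_sum_log_mul_rpow_sub_le (half_pos hc)
  refine ⟨2 / c * (2 / c + K₂) + 1 / 4 * (1 / c + K₁), by positivity,
    fun y Y hy hyY hYy hYc => ?_⟩
  have hy0 : 0 < y := (Real.exp_pos 2).trans_le hy
  have hY0 : 0 < Y := by linarith
  have hL : 2 ≤ Real.log y := (Real.le_log_iff_exp_le hy0).mpr hy
  set l := Real.log y with hl
  have hl0 : 0 < l := by linarith
  set S := (Ioc ⌊y⌋₊ ⌊Y⌋₊).filter Nat.Prime with hS
  have hmem : ∀ p ∈ S, y < p ∧ (p : ℝ) ≤ Y := by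
    intro p hp
    rw [hS, Finset.mem_filter, Finset.mem_Ioc] at hp
    exact ⟨(Nat.floor_lt hy0.le).mp hp.1.1, (Nat.le_floor_iff hY0.le).mp hp.1.2⟩
  have hterm : ∀ p ∈ S,
      |1 / ((p : ℝ) ^ (c + 1) * Real.log (y ^ 3 / p) ^ 2)
        - (p : ℝ) ^ (-(c + 1)) * Real.log p * (1 / (4 * l ^ 3))|
      ≤ 2 / c * (y ^ (-(c / 2)) / l ^ 4) * ((p : ℝ) ^ (-(c / 2 + 1)) * Real.log p) := by
    intro p hp
    obtain ⟨hp1, hp2⟩ := hmem p hp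
    have hp0 : (0 : ℝ) < p := hy0.trans hp1
    set u := Real.log (p / y) with hu
    have hu0 : 0 ≤ u := Real.log_nonneg (by rw [one_le_div hy0]; exact hp1.le)
    have hlogp : Real.log p = l + u := by rw [hu, Real.log_div hp0.ne' hy0.ne']; ring
    have hlogx : Real.log (y ^ 3 / p) = 2 * l - u := by
      rw [Real.log_div (by positivity) hp0.ne', Real.log_pow, hlogp]
      push_cast
      ring
    have hul : u ≤ l / 2 := by
      have : p / y ≤ y ^ (1 / 2 : ℝ) := by
        rw [div_le_iff₀ hy0, mul_comm]
        exact hp2.trans hYy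
      have := Real.log_le_log (by positivity) this
      rw [Real.log_rpow hy0] at this
      linarith
    have hupow : u ≤ 2 / c * ((p : ℝ) ^ (c / 2) * y ^ (-(c / 2))) := by
      have := Real.log_le_rpow_div (show 0 ≤ (p : ℝ) / y by positivity) (half_pos hc)
      rw [Real.div_rpow hp0.le hy0.le] at this
      refine this.trans (le_of_eq ?_)
      rw [Real.rpow_neg hy0.le]
      field_simp
    have hpc : (p : ℝ) ^ (-(c + 1)) * (p : ℝ) ^ (c / 2) = (p : ℝ) ^ (-(c / 2 + 1)) := by
      rw [← Real.rpow_add hp0]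
      ring_nf
    have hlu : 0 < l + u := by linarith
    have heq : 1 / ((p : ℝ) ^ (c + 1) * (2 * l - u) ^ 2)
        - (p : ℝ) ^ (-(c + 1)) * (l + u) * (1 / (4 * l ^ 3))
        = (p : ℝ) ^ (-(c + 1)) * (l + u)
          * (1 / ((l + u) * (2 * l - u) ^ 2) - 1 / (4 * l ^ 3)) := by
      have : 2 * l - u ≠ 0 := by linarith
      rw [Real.rpow_neg hp0.le]
      field_simp
    rw [hlogx, hlogp, heq, abs_mul, abs_of_nonneg (by positivity)]
    calc _ ≤ (p : ℝ) ^ (-(c + 1)) * (l + u)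
          * (2 / c * ((p : ℝ) ^ (c / 2) * y ^ (-(c / 2))) / l ^ 4) := by
          gcongr
          refine (abs_one_div_mul_sq_sub_le hl0 hu0 hul).trans ?_
          gcongr
      _ = _ := by rw [← hpc]; ring
  have hyy : y ^ (-(c / 2)) * y ^ (-(c / 2)) = y ^ (-c) := by
    rw [← Real.rpow_add hy0]
    ring_nf
  have hA : |∑ p ∈ S, 1 / ((p : ℝ) ^ (c + 1) * Real.log (y ^ 3 / p) ^ 2)
      - (∑ p ∈ S, (p : ℝ) ^ (-(c + 1)) * Real.log p) * (1 / (4 * l ^ 3))|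
      ≤ 2 / c * (2 / c + K₂) * (y ^ (-c) / l ^ 4) := by
    rw [Finset.sum_mul, ← Finset.sum_sub_distrib]
    refine ((Finset.abs_sum_le_sum_abs _ _).trans (Finset.sum_le_sum hterm)).trans ?_
    rw [← Finset.mul_sum]
    have h1 : ∑ p ∈ S, (p : ℝ) ^ (-(c / 2 + 1)) * Real.log p ≤ (2 / c + K₂) * y ^ (-(c / 2)) := by
      have h2 := (abs_le.mp (hS₂ y Y hy hyY)).2
      have h3 : y ^ (-(c / 2)) / l ≤ y ^ (-(c / 2)) := div_le_self (by positivity) (by linarith)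
      have h4 : 0 ≤ Y ^ (-(c / 2)) := by positivity
      have h5 : (y ^ (-(c / 2)) - Y ^ (-(c / 2))) / (c / 2) ≤ 2 / c * y ^ (-(c / 2)) := by
        calc _ ≤ y ^ (-(c / 2)) / (c / 2) := by gcongr; linarith
          _ = _ := by field_simp
      have h6 := mul_le_mul_of_nonneg_left h3 hK₂.le
      rw [hS]
      linarith
    calc _ ≤ 2 / c * (y ^ (-(c / 2)) / l ^ 4) * ((2 / c + K₂) * y ^ (-(c / 2))) := by gcongr
      _ = _ := by rw [← hyy]; ring
  have hB : |(∑ p ∈ S, (p : ℝ) ^ (-(c + 1)) * Real.log p) * (1 / (4 * l ^ 3))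
      - y ^ (-c) / (4 * c * l ^ 3)| ≤ 1 / 4 * (1 / c + K₁) * (y ^ (-c) / l ^ 4) := by
    have h1 : |∑ p ∈ S, (p : ℝ) ^ (-(c + 1)) * Real.log p - y ^ (-c) / c|
        ≤ (1 / c + K₁) * (y ^ (-c) / l) := by
      have h2 := hS₁ y Y hy hyY
      have h3 : |(y ^ (-c) - Y ^ (-c)) / c - y ^ (-c) / c| ≤ 1 / c * (y ^ (-c) / l) := by
        rw [show (y ^ (-c) - Y ^ (-c)) / c - y ^ (-c) / c = -(1 / c * Y ^ (-c)) by ring, abs_neg,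
          abs_of_nonneg (by positivity)]
        gcongr
      refine (abs_sub_le _ ((y ^ (-c) - Y ^ (-c)) / c) _).trans ?_
      linarith
    rw [show (∑ p ∈ S, (p : ℝ) ^ (-(c + 1)) * Real.log p) * (1 / (4 * l ^ 3))
        - y ^ (-c) / (4 * c * l ^ 3)
        = (∑ p ∈ S, (p : ℝ) ^ (-(c + 1)) * Real.log p - y ^ (-c) / c) * (1 / (4 * l ^ 3)) by
          field_simp, abs_mul, abs_of_pos (show 0 < 1 / (4 * l ^ 3) by positivity)]
    calc _ ≤ (1 / c + K₁) * (y ^ (-c) / l) * (1 / (4 * l ^ 3)) := by gcongr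
      _ = _ := by field_simp
  refine (abs_sub_le _ _ _).trans ((add_le_add hA hB).trans (le_of_eq ?_))
  ring

/-- For `α > 0`,
`Σ_{x^{1/3} < p ≤ x^{1/3}(log x)^{4/α}} 1/(p^{3α/2+1} (log(x/p))²)
  = (9/(2α))·1/(x^{α/2} log³x) + O(1/(x^{α/2} log⁴x))`, the sum ranging over primes. -/
theorem prime_sum_three_halves_exponent_asymptotic (α : ℝ) (hα : 0 < α) :
    (fun x : ℝ =>
        (∑ p ∈ (Finset.Icc 2 ⌊x ^ ((1:ℝ) / 3) * Real.log x ^ ((4:ℝ) / α)⌋₊).filter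
            (fun p : ℕ => p.Prime ∧ x ^ ((1:ℝ) / 3) < (p : ℝ)),
          1 / ((p : ℝ) ^ (3 * α / 2 + 1) * Real.log (x / (p : ℝ)) ^ 2))
        - (9 / (2 * α)) * (1 / (x ^ (α / 2) * Real.log x ^ 3)))
      =O[atTop] (fun x : ℝ => 1 / (x ^ (α / 2) * Real.log x ^ 4)) := by
  obtain ⟨K, hK, hbound⟩ := exists_abs_sum_one_div_sub_le (c := 3 * α / 2) (by positivity)
  refine Asymptotics.IsBigO.of_bound (81 * K) ?_
  have hlittle := (isLittleO_log_rpow_rpow_atTop (4 / α) (show (0 : ℝ) < 1 / 6 by norm_num)).bound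
    zero_lt_one
  filter_upwards [hlittle, eventually_ge_atTop (Real.exp 6)] with x hx hx6
  have hx0 : 0 < x := (Real.exp_pos 6).trans_le hx6
  have hL : 6 ≤ Real.log x := (Real.le_log_iff_exp_le hx0).mpr hx6
  have hL0 : 0 < Real.log x := by linarith
  set y := x ^ ((1 : ℝ) / 3) with hy
  set Y := y * Real.log x ^ ((4 : ℝ) / α) with hY
  have hy0 : 0 < y := by positivity
  have hlogy : Real.log y = Real.log x / 3 := by rw [hy, Real.log_rpow hx0]; ring
  have hy3 : y ^ 3 = x := by
    rw [hy, ← Real.rpow_natCast, ← Real.rpow_mul hx0.le]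
    norm_num
  have hyc : y ^ (-(3 * α / 2)) = 1 / x ^ (α / 2) := by
    rw [hy, ← Real.rpow_mul hx0.le, one_div (x ^ _), ← Real.rpow_neg hx0.le]
    ring_nf
  have hye : Real.exp 2 ≤ y := by
    rw [← Real.le_log_iff_exp_le hy0, hlogy]
    linarith
  have hyY : y ≤ Y :=
    le_mul_of_one_le_right hy0.le (Real.one_le_rpow (by linarith) (by positivity))
  have hYy : Y ≤ y * y ^ (1 / 2 : ℝ) := by
    rw [hY]
    gcongr
    rw [one_mul, Real.norm_of_nonneg (by positivity), Real.norm_of_nonneg (by positivity)] at hx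
    rw [hy, ← Real.rpow_mul hx0.le]
    norm_num at hx ⊢
    exact hx
  have hYc : Y ^ (-(3 * α / 2)) ≤ y ^ (-(3 * α / 2)) / Real.log y := by
    rw [hY, Real.mul_rpow hy0.le (by positivity), ← Real.rpow_mul hL0.le,
      div_eq_mul_inv _ (Real.log y)]
    refine mul_le_mul_of_nonneg_left ?_ (by positivity)
    rw [show 4 / α * -(3 * α / 2) = -(6 : ℕ) by field_simp; norm_num, Real.rpow_neg hL0.le,
      Real.rpow_natCast, hlogy]
    refine inv_anti₀ (by positivity) ?_
    calc Real.log x / 3 ≤ Real.log x := by linarith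
      _ ≤ Real.log x ^ 6 := le_self_pow₀ (by linarith) (by norm_num)
  have hset : (Finset.Icc 2 ⌊Y⌋₊).filter (fun p : ℕ => p.Prime ∧ y < (p : ℝ))
      = (Ioc ⌊y⌋₊ ⌊Y⌋₊).filter Nat.Prime := by
    ext p
    simp only [Finset.mem_filter, Finset.mem_Icc, Finset.mem_Ioc, Nat.floor_lt hy0.le]
    exact ⟨fun h => ⟨⟨h.2.2, h.1.2⟩, h.2.1⟩, fun h => ⟨⟨h.2.two_le, h.1.2⟩, h.2, h.1.1⟩⟩
  have h := hbound y Y hye hyY hYy hYc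
  rw [hy3, hyc, hlogy] at h
  rw [hset, Real.norm_eq_abs, Real.norm_of_nonneg (by positivity)]
  have e1 : 1 / x ^ (α / 2) / (4 * (3 * α / 2) * (Real.log x / 3) ^ 3)
      = 9 / (2 * α) * (1 / (x ^ (α / 2) * Real.log x ^ 3)) := by
    field_simp
    norm_num
  have e2 : K * (1 / x ^ (α / 2) / (Real.log x / 3) ^ 4)
      = 81 * K * (1 / (x ^ (α / 2) * Real.log x ^ 4)) := by
    field_simp
    norm_num
  rwa [e1, e2] at h
end

section
/- Let α > 4/5 be a real number. For n > 1 let p(n) denote the smallest prime divisor of n, P(n) the largest prime divisor of n, ω(n) the number of distinct prime divisors of n, and μ the Möbius function. Then as x → ∞, Σ_{1 < n ≤ x, μ(n) ≠ 0, ω(n) ≥ 6} (p(n)/P(n))^α = O(x/(log x)^4). -/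
open Filter Finset

/-- A Chebyshev-type bound for the reciprocals of the primes in a dyadic interval. -/
theorem sum_inv_primes_dyadic_mul_le (i : ℕ) :
    (∑ q ∈ (Ico (2 ^ i) (2 ^ (i + 1))).filter Nat.Prime, (1 : ℝ) / q) * i ≤ 4 := by
  set S := (Ico (2 ^ i) (2 ^ (i + 1))).filter Nat.Prime with hS
  have h1 : (2 ^ i) ^ S.card ≤ ∏ q ∈ S, q := by
    refine Finset.pow_card_le_prod _ _ _ fun q hq => ?_
    simp only [hS, mem_filter, mem_Ico] at hq
    exact hq.1.1
  have h2 : ∏ q ∈ S, q ≤ primorial (2 ^ (i + 1)) := by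
    refine Finset.prod_le_prod_of_subset_of_one_le' (fun q hq => ?_) fun q hq _ => ?_
    · simp only [hS, mem_filter, mem_Ico, mem_range] at hq ⊢
      exact ⟨by omega, hq.2⟩
    · exact (mem_filter.1 hq).2.one_le
  have h3 : 2 ^ (i * S.card) ≤ 2 ^ (2 * 2 ^ (i + 1)) := by
    calc 2 ^ (i * S.card) = (2 ^ i) ^ S.card := pow_mul ..
      _ ≤ 4 ^ (2 ^ (i + 1)) := h1.trans (h2.trans (primorial_le_four_pow _))
      _ = 2 ^ (2 * 2 ^ (i + 1)) := by rw [pow_mul]; norm_num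
  have h4 : i * S.card ≤ 2 * 2 ^ (i + 1) := (Nat.pow_le_pow_iff_right (by norm_num)).1 h3
  have h5 : ∑ q ∈ S, (1 : ℝ) / q ≤ S.card * (1 / 2 ^ i) := by
    rw [← nsmul_eq_mul]
    refine Finset.sum_le_card_nsmul _ _ _ fun q hq => ?_
    simp only [hS, mem_filter, mem_Ico] at hq
    exact one_div_le_one_div_of_le (by positivity) (by exact_mod_cast hq.1.1)
  have h6 : (i : ℝ) * S.card ≤ 4 * 2 ^ i := by
    have : ((i * S.card : ℕ) : ℝ) ≤ (2 * 2 ^ (i + 1) : ℕ) := by exact_mod_cast h4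
    push_cast at this
    rw [pow_succ] at this
    linarith
  calc _ ≤ (S.card * (1 / 2 ^ i) : ℝ) * i := by gcongr
    _ = (i * S.card) / 2 ^ i := by ring
    _ ≤ 4 := by rw [div_le_iff₀ (by positivity)]; exact h6

theorem sum_inv_primes_Ico_two_pow_le {J : ℝ} (hJ : 0 < J) {a : ℕ} (ha : J ≤ a) (d : ℕ) :
    ∑ q ∈ (Ico (2 ^ a) (2 ^ (a + d))).filter Nat.Prime, (1 : ℝ) / q ≤ d * (4 / J) := by
  induction d with
  | zero => simp
  | succ d ih =>
    have hle : ∑ q ∈ (Ico (2 ^ (a + d)) (2 ^ (a + d + 1))).filter Nat.Prime, (1 : ℝ) / q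
        ≤ 4 / J := by
      rw [le_div_iff₀ hJ]
      refine le_trans ?_ (sum_inv_primes_dyadic_mul_le (a + d))
      gcongr
      push_cast
      linarith [(Nat.cast_nonneg d : (0 : ℝ) ≤ d)]
    have hsplit : Ico (2 ^ a) (2 ^ (a + (d + 1)))
        = Ico (2 ^ a) (2 ^ (a + d)) ∪ Ico (2 ^ (a + d)) (2 ^ (a + d + 1)) := by
      rw [Ico_union_Ico_eq_Ico, add_assoc] <;> exact Nat.pow_le_pow_right (by norm_num) (by omega)
    rw [hsplit, filter_union, sum_union]
    · push_cast
      linarith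
    · exact disjoint_filter_filter (Ico_disjoint_Ico_consecutive _ _ _)

/-- Integers with at least `r` prime factors, all taken from `W`, number at most
`N (∑_{q ∈ W} 1 / q) ^ r` up to `N`. -/
theorem card_primeFactors_subset_le (W : Finset ℕ) (N r : ℕ) :
    (((Ioc 0 N).filter fun n => r ≤ n.primeFactors.card ∧ n.primeFactors ⊆ W).card : ℝ)
      ≤ N * (∑ q ∈ W, (1 : ℝ) / q) ^ r := by
  classical
  have hsub : ((Ioc 0 N).filter fun n => r ≤ n.primeFactors.card ∧ n.primeFactors ⊆ W)
      ⊆ (Fintype.piFinset fun _ : Fin r => W).biUnion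
        fun f => (Ioc 0 N).filter fun n => (∏ i, f i) ∣ n := by
    intro n hn
    simp only [mem_filter] at hn
    obtain ⟨hN, hr, hW⟩ := hn
    obtain ⟨t, ht, htr⟩ := exists_subset_card_eq hr
    let e := (t.equivFinOfCardEq htr).symm
    simp only [mem_biUnion, mem_filter, Fintype.mem_piFinset]
    refine ⟨fun i => e i, fun i => hW (ht (e i).2), hN, ?_⟩
    have : ∏ i, ((e i : t) : ℕ) = ∏ q ∈ t, q := by
      rw [Equiv.prod_comp e (fun q : t => (q : ℕ)), Finset.prod_coe_sort t (fun q => q)]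
    rw [this]
    exact (prod_dvd_prod_of_subset _ _ _ ht).trans (Nat.prod_primeFactors_dvd n)
  calc (_ : ℝ) ≤ ((∑ f ∈ Fintype.piFinset fun _ : Fin r => W, N / ∏ i, f i : ℕ) : ℝ) := by
        refine Nat.cast_le.2 ((card_le_card hsub).trans (card_biUnion_le.trans ?_))
        simp [Nat.Ioc_filter_dvd_card_eq_div]
    _ ≤ ∑ f ∈ Fintype.piFinset fun _ : Fin r => W, (N : ℝ) * ∏ i, (1 : ℝ) / f i := by
        rw [Nat.cast_sum]
        refine sum_le_sum fun f _ => Nat.cast_div_le.trans (le_of_eq ?_)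
        push_cast
        rw [prod_div_distrib, prod_const_one, mul_one_div]
    _ = _ := by rw [← mul_sum, sum_pow']

theorem card_le_card_primeFactors_mul_le (N m : ℕ) :
    (((Ioc 0 N).filter fun n => m ≤ n.primeFactors.card).card : ℝ) * 2 ^ m
      ≤ N * (1 + Real.log N) := by
  have h1 : ((Ioc 0 N).filter fun n => m ≤ n.primeFactors.card).card * 2 ^ m
      ≤ ∑ n ∈ Ioc 0 N, n.divisors.card := by
    rw [← smul_eq_mul]
    refine (card_nsmul_le_sum _ _ _ fun n hn => ?_).trans
      (sum_le_sum_of_subset (filter_subset _ _))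
    simp only [mem_filter, mem_Ioc] at hn
    rw [Nat.card_divisors (by omega)]
    refine (Nat.pow_le_pow_right (by norm_num) hn.2).trans
      (Finset.pow_card_le_prod _ _ _ fun q hq => ?_)
    have := (Nat.prime_of_mem_primeFactors hq).factorization_pos_of_dvd (by omega)
      (Nat.dvd_of_mem_primeFactors hq)
    omega
  have h2 : ∑ n ∈ Ioc 0 N, n.divisors.card = ∑ d ∈ Ioc 0 N, N / d := by
    have h : ∀ n ∈ Ioc 0 N, n.divisors.card = ∑ d ∈ Ioc 0 N, if d ∣ n then 1 else 0 := by
      intro n hn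
      rw [sum_boole, Nat.cast_id]
      congr 1
      ext d
      simp only [mem_Ioc, Nat.mem_divisors, mem_filter] at hn ⊢
      constructor
      · rintro ⟨hd, -⟩
        exact ⟨⟨Nat.pos_of_dvd_of_pos hd hn.1, (Nat.le_of_dvd hn.1 hd).trans hn.2⟩, hd⟩
      · rintro ⟨-, hd⟩
        exact ⟨hd, by omega⟩
    rw [sum_congr rfl h, sum_comm]
    refine sum_congr rfl fun d _ => ?_
    rw [sum_boole, Nat.cast_id, Nat.Ioc_filter_dvd_card_eq_div]
  have h3 : ((∑ d ∈ Ioc 0 N, N / d : ℕ) : ℝ) ≤ N * (harmonic N : ℝ) := by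
    rw [harmonic_eq_sum_Icc, Nat.cast_sum, Rat.cast_sum, mul_sum]
    refine sum_le_sum fun d _ => Nat.cast_div_le.trans (le_of_eq ?_)
    push_cast
    rw [div_eq_mul_inv]
  calc _ ≤ ((∑ d ∈ Ioc 0 N, N / d : ℕ) : ℝ) := by exact_mod_cast h2 ▸ h1
    _ ≤ N * (harmonic N : ℝ) := h3
    _ ≤ _ := by gcongr; exact harmonic_le_one_add_log N

theorem sup_primeFactors_mem {n : ℕ} (hn : 2 ≤ n) : n.primeFactors.sup id ∈ n.primeFactors := by
  obtain ⟨q, hq, h⟩ := exists_mem_eq_sup n.primeFactors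
    (Nat.nonempty_primeFactors.2 (by omega)) id
  rw [h]
  exact hq

theorem Squarefree.le_sup_primeFactors_pow_card {n : ℕ} (hn : Squarefree n) :
    n ≤ n.primeFactors.sup id ^ n.primeFactors.card := by
  conv_lhs => rw [← Nat.prod_primeFactors_of_squarefree hn]
  exact prod_le_pow_card _ _ _ fun q hq => le_sup (f := id) hq

/-- If `n` has few prime factors, whose ratios are bounded by `2 ^ m`, then they all lie in a
window `[2 ^ a, 2 ^ (a + m + 1))` with `a` large. -/
theorem exists_primeFactors_subset_Ico_two_pow {n N m : ℕ} {L : ℝ} (hn2 : 2 ≤ n) (hnN : n ≤ N)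
    (hsq : Squarefree n) (hm : 0 < m) (hmL : 4 * m * (m + 1) ≤ L) (hn : L / 2 ≤ Real.log n)
    (hcard : n.primeFactors.card ≤ m) (hratio : n.primeFactors.sup id ≤ 2 ^ m * n.minFac) :
    ∃ a ∈ (range (Nat.log 2 N + 1)).filter fun a : ℕ => L / (4 * m) ≤ a,
      n.primeFactors ⊆ (Ico (2 ^ a) (2 ^ (a + (m + 1)))).filter Nat.Prime := by
  set P := n.primeFactors.sup id with hP
  have hPmem : P ∈ n.primeFactors := sup_primeFactors_mem hn2
  have hPprime := Nat.prime_of_mem_primeFactors hPmem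
  have hPN : P ≤ N := (Nat.le_of_mem_primeFactors hPmem).trans hnN
  set j := Nat.log 2 P with hj
  have hjP : 2 ^ j ≤ P := Nat.pow_log_le_self 2 hPprime.ne_zero
  have hPj : P < 2 ^ (j + 1) := Nat.lt_pow_succ_log_self (by norm_num) P
  have hm0 : (0 : ℝ) < m := by exact_mod_cast hm
  have hlog : L / 2 ≤ m * (j + 1) := by
    have h1 : n ≤ 2 ^ ((j + 1) * m) := by
      rw [pow_mul]
      calc n ≤ P ^ n.primeFactors.card := hsq.le_sup_primeFactors_pow_card
        _ ≤ P ^ m := Nat.pow_le_pow_right hPprime.pos hcard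
        _ ≤ _ := Nat.pow_le_pow_left hPj.le m
    have h2 : Real.log n ≤ ((j + 1) * m : ℕ) * Real.log 2 := by
      rw [← Real.log_pow]
      exact Real.log_le_log (by positivity) (by exact_mod_cast h1)
    have h3 : ((j + 1) * m : ℕ) * Real.log 2 ≤ ((j + 1) * m : ℕ) * 1 := by
      gcongr
      linarith [Real.log_two_lt_d9]
    push_cast at h2 h3
    linarith
  have hja : L / (4 * m) + m ≤ j := by
    have h1 : L / (4 * m) + (m + 1) ≤ j + 1 := by
      have h2 : (m + 1 : ℝ) ≤ L / (4 * m) := by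
        rw [le_div_iff₀ (by positivity)]
        linarith
      have h3 : L / (4 * m) + L / (4 * m) ≤ j + 1 := by
        rw [show L / (4 * m) + L / (4 * m) = L / 2 / m by field_simp; ring,
          div_le_iff₀ hm0]
        linarith
      linarith
    linarith
  have hL0 : 0 ≤ L / (4 * m) := div_nonneg (le_trans (by positivity) hmL) (by positivity)
  have hmj : m ≤ j := by
    have : (m : ℝ) ≤ j := by linarith
    exact_mod_cast this
  refine ⟨j - m, ?_, fun q hq => ?_⟩
  · simp only [mem_filter, mem_range]
    refine ⟨?_, ?_⟩
    · have : j ≤ Nat.log 2 N := Nat.log_mono_right hPN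
      omega
    · rw [Nat.cast_sub hmj]
      linarith
  · have hqp := Nat.prime_of_mem_primeFactors hq
    simp only [mem_filter, mem_Ico]
    refine ⟨⟨?_, ?_⟩, hqp⟩
    · have h1 : 2 ^ m * 2 ^ (j - m) ≤ 2 ^ m * q := by
        rw [← pow_add, Nat.add_sub_cancel' hmj]
        exact hjP.trans (hratio.trans (Nat.mul_le_mul_left _
          (Nat.minFac_le_of_dvd hqp.two_le (Nat.dvd_of_mem_primeFactors hq))))
      exact Nat.le_of_mul_le_mul_left h1 (by positivity)
    · have h1 : q ≤ P := le_sup (f := id) hq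
      rw [show j - m + (m + 1) = j + 1 by omega]
      omega

theorem sum_minFac_div_sup_primeFactors_le {α x : ℝ} (hα : 4 / 5 < α) (hx : 1 < x) {m : ℕ}
    (hm : 0 < m) (hL : 2 ≤ Real.log x) (hm2 : Real.log x ^ 6 ≤ 2 ^ m)
    (hL4 : Real.log x ^ 4 ≤ Real.exp (Real.log x / 2))
    (hmL : 3 * (16 * m * (m + 1)) ^ 6 ≤ Real.log x) :
    ∑ n ∈ (Finset.Icc 2 ⌊x⌋₊).filter (fun n => Squarefree n ∧ 6 ≤ n.primeFactors.card),
      ((n.minFac : ℝ) / ((n.primeFactors.sup id : ℕ) : ℝ)) ^ α ≤ 4 * (x / Real.log x ^ 4) := by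
  classical
  set L := Real.log x with hLdef
  set N := ⌊x⌋₊ with hN
  have hx0 : 0 < x := by linarith
  have hL0 : 0 < L := by linarith
  have hm0 : (0 : ℝ) < m := by exact_mod_cast hm
  have hNx : (N : ℝ) ≤ x := Nat.floor_le hx0.le
  have hN1 : 1 ≤ N := Nat.le_floor (by exact_mod_cast hx.le)
  set y : ℝ := 16 * m * (m + 1) with hy
  have hy1 : 1 ≤ y := by
    have : (1 : ℝ) ≤ m := by exact_mod_cast hm
    nlinarith
  have hyL : y ≤ L := by
    have : y ≤ y ^ 6 := le_self_pow₀ hy1 (by norm_num)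
    linarith [pow_nonneg (zero_le_one.trans hy1) 6]
  set S := (Finset.Icc 2 N).filter (fun n => Squarefree n ∧ 6 ≤ n.primeFactors.card) with hS
  set A := Ioc 0 ⌊x / L ^ 4⌋₊ with hA
  set C := (Ioc 0 N).filter fun n => m ≤ n.primeFactors.card with hC
  set I := (range (Nat.log 2 N + 1)).filter fun a : ℕ => L / (4 * m) ≤ a with hI
  set D := I.biUnion fun a => (Ioc 0 N).filter fun n => 6 ≤ n.primeFactors.card ∧
    n.primeFactors ⊆ (Ico (2 ^ a) (2 ^ (a + (m + 1)))).filter Nat.Prime with hD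
  have hcardA : (A.card : ℝ) ≤ x / L ^ 4 := by
    rw [hA, Nat.card_Ioc, Nat.sub_zero]
    exact Nat.floor_le (by positivity)
  have hcardC : (C.card : ℝ) ≤ x / L ^ 4 := by
    have h1 := card_le_card_primeFactors_mul_le N m
    have h2 : Real.log N ≤ L := Real.log_le_log (by exact_mod_cast hN1) hNx
    have h3 : (C.card : ℝ) * L ^ 6 ≤ x * L ^ 2 := by
      calc (C.card : ℝ) * L ^ 6 ≤ C.card * 2 ^ m := by gcongr
        _ ≤ N * (1 + Real.log N) := h1
        _ ≤ x * (1 + L) := by gcongr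
        _ ≤ x * L ^ 2 := by gcongr; nlinarith
    rw [le_div_iff₀ (by positivity)]
    have h4 : (C.card : ℝ) * L ^ 4 * L ^ 2 ≤ x * L ^ 2 := by
      calc _ = (C.card : ℝ) * L ^ 6 := by ring
        _ ≤ _ := h3
    exact le_of_mul_le_mul_right h4 (by positivity)
  have hcardI : (I.card : ℝ) ≤ 3 * L := by
    have h1 : I.card ≤ Nat.log 2 N + 1 := (card_filter_le _ _).trans (card_range _).le
    have h2 : (2 : ℝ) ^ Nat.log 2 N ≤ x :=
      le_trans (by exact_mod_cast Nat.pow_log_le_self 2 (by omega)) hNx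
    have h3 : Nat.log 2 N * Real.log 2 ≤ L := by
      rw [← Real.log_pow]
      exact Real.log_le_log (by positivity) h2
    have h4 : (I.card : ℝ) ≤ Nat.log 2 N + 1 := by exact_mod_cast h1
    nlinarith [Real.log_two_gt_d9, (Nat.cast_nonneg (Nat.log 2 N) : (0 : ℝ) ≤ _)]
  have hcardD : (D.card : ℝ) ≤ x / L ^ 4 := by
    calc (D.card : ℝ) ≤ ∑ a ∈ I, (((Ioc 0 N).filter fun n => 6 ≤ n.primeFactors.card ∧
          n.primeFactors ⊆ (Ico (2 ^ a) (2 ^ (a + (m + 1)))).filter Nat.Prime).card : ℝ) := by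
          exact_mod_cast card_biUnion_le
      _ ≤ ∑ a ∈ I, x * (y / L) ^ 6 := by
          refine sum_le_sum fun a ha => (card_primeFactors_subset_le _ N 6).trans ?_
          have h1 := sum_inv_primes_Ico_two_pow_le (J := L / (4 * m)) (by positivity)
            (mem_filter.1 ha).2 (m + 1)
          have h2 : ((m + 1 : ℕ) : ℝ) * (4 / (L / (4 * m))) = y / L := by
            rw [hy]
            push_cast
            field_simp
            ring
          rw [h2] at h1
          gcongr
      _ = I.card * (x * (y / L) ^ 6) := by rw [sum_const, nsmul_eq_mul]
      _ ≤ 3 * L * (x * (y / L) ^ 6) := by gcongr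
      _ = 3 * y ^ 6 * (x / L ^ 5) := by field_simp
      _ ≤ L * (x / L ^ 5) := by gcongr
      _ = x / L ^ 4 := by field_simp
  have hpt : ∀ n ∈ S, ((n.minFac : ℝ) / ((n.primeFactors.sup id : ℕ) : ℝ)) ^ α ≤
      1 / L ^ 4 + (if n ∈ A ∪ (C ∪ D) then 1 else 0) := by
    intro n hn
    simp only [hS, mem_filter, mem_Icc] at hn
    obtain ⟨⟨hn2, hnN⟩, hsq, h6⟩ := hn
    have hPmem := sup_primeFactors_mem hn2
    set P := n.primeFactors.sup id with hP
    have hPprime := Nat.prime_of_mem_primeFactors hPmem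
    have hP0 : (0 : ℝ) < P := by exact_mod_cast hPprime.pos
    have hminP : n.minFac ≤ P :=
      Nat.minFac_le_of_dvd hPprime.two_le (Nat.dvd_of_mem_primeFactors hPmem)
    split_ifs with hmem
    · have h1 : ((n.minFac : ℝ) / (P : ℝ)) ^ α ≤ 1 := by
        refine Real.rpow_le_one (by positivity) ?_ (by linarith)
        rw [div_le_one hP0]
        exact_mod_cast hminP
      have h2 : 0 ≤ 1 / L ^ 4 := by positivity
      linarith
    · simp only [mem_union, not_or] at hmem
      obtain ⟨hnA, hnC, hnD⟩ := hmem
      have hcard : n.primeFactors.card ≤ m := by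
        by_contra h
        exact hnC (mem_filter.2 ⟨mem_Ioc.2 ⟨by omega, hnN⟩, by omega⟩)
      have hlogn : L / 2 ≤ Real.log n := by
        have h1 : x / L ^ 4 < n := by
          by_contra h
          exact hnA (mem_Ioc.2 ⟨by omega, Nat.le_floor (not_lt.1 h)⟩)
        have h2 : Real.exp (L / 2) ≤ x / L ^ 4 := by
          rw [le_div_iff₀ (by positivity)]
          calc _ ≤ Real.exp (L / 2) * Real.exp (L / 2) := by gcongr
            _ = x := by rw [← Real.exp_add, add_halves, hLdef, Real.exp_log hx0]
        rw [Real.le_log_iff_exp_le (by positivity)]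
        linarith
      have hratio : 2 ^ m * n.minFac < P := by
        by_contra h
        obtain ⟨a, ha, haW⟩ := exists_primeFactors_subset_Ico_two_pow hn2 hnN hsq hm
          (by nlinarith) hlogn hcard (not_lt.1 h)
        exact hnD (mem_biUnion.2 ⟨a, ha, mem_filter.2 ⟨mem_Ioc.2 ⟨by omega, hnN⟩, h6, haW⟩⟩)
      have h1 : (n.minFac : ℝ) / P ≤ (L ^ (6 : ℝ))⁻¹ := by
        have h2 : (2 : ℝ) ^ m * n.minFac ≤ P := by exact_mod_cast hratio.le
        rw [div_le_iff₀ hP0, inv_mul_eq_div, le_div_iff₀ (by positivity)]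
        have h3 : L ^ (6 : ℝ) = L ^ 6 := by exact_mod_cast Real.rpow_natCast L 6
        rw [h3]
        calc (n.minFac : ℝ) * L ^ 6 ≤ n.minFac * 2 ^ m := by gcongr
          _ ≤ P := by linarith
      calc ((n.minFac : ℝ) / P) ^ α ≤ ((L ^ (6 : ℝ))⁻¹) ^ α :=
            Real.rpow_le_rpow (by positivity) h1 (by linarith)
        _ = (L ^ (6 * α))⁻¹ := by rw [Real.inv_rpow (by positivity), Real.rpow_mul hL0.le]
        _ ≤ (L ^ (4 : ℝ))⁻¹ := by
            gcongr
            · linarith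
            · linarith
        _ = 1 / L ^ 4 + 0 := by
            have h3 : L ^ (4 : ℝ) = L ^ 4 := by exact_mod_cast Real.rpow_natCast L 4
            rw [h3, add_zero, one_div]
  have hcardS : (S.card : ℝ) ≤ x := by
    refine le_trans ?_ hNx
    have : S.card ≤ (Icc 2 N).card := card_filter_le _ _
    rw [Nat.card_Icc] at this
    exact_mod_cast (by omega : S.card ≤ N)
  have hcardU : (((A ∪ (C ∪ D)).card : ℕ) : ℝ) ≤ A.card + (C.card + D.card) := by
    exact_mod_cast (card_union_le _ _).trans (Nat.add_le_add_left (card_union_le _ _) _)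
  calc _ ≤ ∑ n ∈ S, (1 / L ^ 4 + (if n ∈ A ∪ (C ∪ D) then (1 : ℝ) else 0)) := sum_le_sum hpt
    _ = S.card * (1 / L ^ 4) + ((S.filter (· ∈ A ∪ (C ∪ D))).card : ℝ) := by
        rw [sum_add_distrib, sum_const, nsmul_eq_mul, sum_boole]
    _ ≤ x * (1 / L ^ 4) + ((A ∪ (C ∪ D)).card : ℝ) := by
        gcongr
        exact fun n hn => (mem_filter.1 hn).2
    _ ≤ 4 * (x / L ^ 4) := by
        rw [mul_one_div]
        linarith

/-- For `α > 4/5`, the sum over squarefree `n ≤ x` with at least six distinct prime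
factors satisfies `Σ_{1 < n ≤ x, μ(n) ≠ 0, ω(n) ≥ 6} (p(n)/P(n))^α = O(x/log⁴x)`. -/
theorem squarefree_at_least_six_prime_factors_ratio_sum
    (α : ℝ) (hα : 4 / 5 < α) :
    (fun x : ℝ =>
        ∑ n ∈ (Finset.Icc 2 ⌊x⌋₊).filter
            (fun n => Squarefree n ∧ 6 ≤ n.primeFactors.card),
          ((n.minFac : ℝ) / ((n.primeFactors.sup id : ℕ) : ℝ)) ^ α)
      =O[atTop] (fun x : ℝ => x / Real.log x ^ 4) := by
  refine Asymptotics.IsBigO.of_bound 4 ?_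
  have hlog := Real.tendsto_log_atTop
  have h4 : ∀ᶠ L : ℝ in atTop, L ^ 4 ≤ Real.exp (L / 2) := by
    have h := (isLittleO_pow_exp_pos_mul_atTop 4 (b := 1 / 2) (by norm_num)).bound one_pos
    filter_upwards [h] with L hL
    rw [one_mul, Real.norm_eq_abs, Real.norm_eq_abs, Real.abs_exp] at hL
    rw [div_eq_inv_mul, ← one_div]
    exact (le_abs_self _).trans hL
  have h12 : ∀ᶠ L : ℝ in atTop, 3 * (16 * 12 ^ 2 : ℝ) ^ 6 * Real.log L ^ 12 ≤ L := by
    have h := (Real.isLittleO_pow_log_id_atTop (n := 12)).bound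
      (c := (3 * (16 * 12 ^ 2 : ℝ) ^ 6)⁻¹) (by positivity)
    filter_upwards [h, eventually_ge_atTop 0] with L hL hL0
    rw [id, Real.norm_eq_abs, Real.norm_eq_abs, abs_of_nonneg hL0,
      ← div_eq_inv_mul, le_div_iff₀' (by positivity)] at hL
    exact (mul_le_mul_of_nonneg_left (le_abs_self _) (by positivity)).trans hL
  filter_upwards [eventually_gt_atTop 1, hlog.eventually h4, hlog.eventually h12,
    hlog.eventually (eventually_ge_atTop 2),
    hlog.eventually (Real.tendsto_log_atTop.eventually (eventually_ge_atTop 1))]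
    with x hx1 hx4 hx12 hx2 hxl
  set l := Real.log (Real.log x) with hl
  have hL0 : 0 < Real.log x := by linarith
  have hm1 : 10 * l ≤ (⌈10 * l⌉₊ : ℝ) := Nat.le_ceil _
  have hm2 : (⌈10 * l⌉₊ : ℝ) < 10 * l + 1 := Nat.ceil_lt_add_one (by linarith)
  have hmain := sum_minFac_div_sup_primeFactors_le hα hx1 (m := ⌈10 * l⌉₊)
    (Nat.ceil_pos.2 (by linarith)) hx2 ?_ hx4 ?_
  · rw [Real.norm_of_nonneg (sum_nonneg fun n _ => by positivity),
      Real.norm_of_nonneg (by positivity)]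
    exact hmain
  · rw [← Real.log_le_log_iff (by positivity) (by positivity), Real.log_pow, Real.log_pow]
    push_cast
    nlinarith [Real.log_two_gt_d9]
  · refine le_trans ?_ hx12
    calc 3 * (16 * (⌈10 * l⌉₊ : ℝ) * (⌈10 * l⌉₊ + 1)) ^ 6
        ≤ 3 * (16 * (12 * l) * (12 * l)) ^ 6 := by
          gcongr <;> linarith
      _ = _ := by ring
end
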